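/- arXiv:1304.4481 — 5 statements merged into one kernel-verified Lean document; each statement's English description precedes it below -/
import Mathlib

section
/- Let R be a ring, let P be a class of right R-modules closed under isomorphism, finite direct products and direct summands, and let S be the class of left R-modules M whose character module M* belongs to P. If 0 → L → M → N → 0 is a pure-exact sequence of left R-modules, then M ∈ S if and only if both L ∈ S and N ∈ S. -/
universe u

open MulOpposite DirectSum

noncomputable section

/-- The additive group `ℚ/ℤ`. -/
abbrev RatCircle : Type := AddCircle (1 : ℚ)

/-- The character group `Hom_ℤ(M, ℚ/ℤ)` of an abelian group `M`. -/
def Character (M : Type u) [AddCommGroup M] : Type u := M →+ RatCircle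

namespace Character

instance instAddCommGroup (M : Type u) [AddCommGroup M] : AddCommGroup (Character M) :=
  inferInstanceAs (AddCommGroup (M →+ RatCircle))

instance instFunLike (M : Type u) [AddCommGroup M] : FunLike (Character M) M RatCircle :=
  inferInstanceAs (FunLike (M →+ RatCircle) M RatCircle)

instance instAddMonoidHomClass (M : Type u) [AddCommGroup M] :
    AddMonoidHomClass (Character M) M RatCircle :=
  inferInstanceAs (AddMonoidHomClass (M →+ RatCircle) M RatCircle)

@[ext] lemma ext {M : Type u} [AddCommGroup M] {f g : Character M}
    (h : ∀ m, f m = g m) : f = g := DFunLike.ext _ _ h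

variable {R : Type u} [Ring R]

/-- If `M` is a left `R`-module then `Character M` is a right `R`-module,
via `(f • r) m = f (r • m)`. -/
instance instSMulRight {M : Type u} [AddCommGroup M] [Module R M] :
    SMul Rᵐᵒᵖ (Character M) where
  smul r f :=
    ((f : M →+ RatCircle).comp (DistribMulAction.toAddMonoidHom M r.unop) : M →+ RatCircle)

lemma smul_right_apply {M : Type u} [AddCommGroup M] [Module R M]
    (r : Rᵐᵒᵖ) (f : Character M) (m : M) : (r • f) m = f (r.unop • m) := rfl

instance moduleRight {M : Type u} [AddCommGroup M] [Module R M] :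
    Module Rᵐᵒᵖ (Character M) where
  one_smul f := ext fun m => by rw [smul_right_apply, unop_one, one_smul]
  mul_smul r s f := ext fun m => by
    rw [smul_right_apply, smul_right_apply, smul_right_apply, unop_mul, mul_smul]
  smul_zero r := ext fun m => rfl
  smul_add r f g := ext fun m => rfl
  add_smul r s f := ext fun m => by
    show f ((r + s).unop • m) = f (r.unop • m) + f (s.unop • m)
    rw [unop_add, add_smul, map_add]
  zero_smul f := ext fun m => by
    show f ((0 : Rᵐᵒᵖ).unop • m) = 0
    rw [unop_zero, zero_smul, map_zero]

/-- If `M` is a right `R`-module then `Character M` is a left `R`-module,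
via `(r • f) m = f (m • r)`. -/
instance instSMulLeft {M : Type u} [AddCommGroup M] [Module Rᵐᵒᵖ M] :
    SMul R (Character M) where
  smul r f :=
    ((f : M →+ RatCircle).comp (DistribMulAction.toAddMonoidHom M (op r)) : M →+ RatCircle)

lemma smul_left_apply {M : Type u} [AddCommGroup M] [Module Rᵐᵒᵖ M]
    (r : R) (f : Character M) (m : M) : (r • f) m = f (op r • m) := rfl

instance moduleLeft {M : Type u} [AddCommGroup M] [Module Rᵐᵒᵖ M] :
    Module R (Character M) where
  one_smul f := ext fun m => by rw [smul_left_apply, op_one, one_smul]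
  mul_smul r s f := ext fun m => by
    rw [smul_left_apply, smul_left_apply, smul_left_apply, op_mul, mul_smul]
  smul_zero r := ext fun m => rfl
  smul_add r f g := ext fun m => rfl
  add_smul r s f := ext fun m => by
    show f (op (r + s) • m) = f (op r • m) + f (op s • m)
    rw [op_add, add_smul, map_add]
  zero_smul f := ext fun m => by
    show f (op (0 : R) • m) = 0
    rw [op_zero, zero_smul, map_zero]

end Character

section Defs

variable (A : Type u) [Ring A]

/-- A pure embedding: an injective linear map such that every finite system of
linear equations with constants in `L` solvable in `M` is solvable in `L`. -/
def IsPureEmbedding {L M : Type u} [AddCommGroup L] [AddCommGroup M]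
    [Module A L] [Module A M] (i : L →ₗ[A] M) : Prop :=
  Function.Injective i ∧
    ∀ (m n : ℕ) (r : Matrix (Fin m) (Fin n) A) (l : Fin m → L),
      (∃ x : Fin n → M, ∀ j, (∑ k, r j k • x k) = i (l j)) →
      ∃ y : Fin n → L, ∀ j, (∑ k, r j k • y k) = l j

/-- A module is pure-injective if every pure embedding out of it splits. -/
def IsPureInjective (N : Type u) [AddCommGroup N] [Module A N] : Prop :=
  ∀ (M : Type u) [AddCommGroup M] [Module A M] (i : N →ₗ[A] M),
    IsPureEmbedding A i → ∃ π : M →ₗ[A] N, π.comp i = LinearMap.id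

/-- `N` is (isomorphic to) a direct summand of `N'`. -/
def IsDirectSummand (N N' : Type u) [AddCommGroup N] [AddCommGroup N']
    [Module A N] [Module A N'] : Prop :=
  ∃ (i : N →ₗ[A] N') (π : N' →ₗ[A] N), π.comp i = LinearMap.id

/-- A module is indecomposable if it is nonzero and is not the internal direct sum
of two nonzero submodules. -/
def IsIndecomposable (N : Type u) [AddCommGroup N] [Module A N] : Prop :=
  (∃ x : N, x ≠ 0) ∧ ∀ U V : Submodule A N, U ≠ ⊥ → V ≠ ⊥ → ¬ IsCompl U V

/-- An injective module: every linear map from a submodule of a module `B` into `E`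
extends to `B`. -/
def IsInjectiveModule (E : Type u) [AddCommGroup E] [Module A E] : Prop :=
  ∀ (B : Type u) [AddCommGroup B] [Module A B] (L : Submodule A B) (g : L →ₗ[A] E),
    ∃ h : B →ₗ[A] E, ∀ x : L, h x = g x

/-- A cogenerator: points of any module are separated by maps into `E`. -/
def IsCogenerator (E : Type u) [AddCommGroup E] [Module A E] : Prop :=
  ∀ (X : Type u) [AddCommGroup X] [Module A X] (x : X), x ≠ 0 →
    ∃ g : X →ₗ[A] E, g x ≠ 0

/-- A class of modules is closed under (arbitrary) direct products. -/
def ProdClosed (C : ModuleCat.{u} A → Prop) : Prop :=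
  ∀ (ι : Type u) (f : ι → ModuleCat.{u} A), (∀ i, C (f i)) →
    C (ModuleCat.of A (∀ i, (f i : Type u)))

/-- A class of modules is closed under modules purely embedding into its members. -/
def PureSubClosed (C : ModuleCat.{u} A → Prop) : Prop :=
  ∀ (N M : ModuleCat.{u} A) (i : N →ₗ[A] M), IsPureEmbedding A i → C M → C N

/-- A class of modules is closed under colimits of directed systems. -/
def DirLimClosed (C : ModuleCat.{u} A → Prop) : Prop :=
  ∀ (ι : Type u) [Preorder ι] [IsDirected ι (· ≤ ·)] [Nonempty ι] [DecidableEq ι]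
    (G : ι → Type u) [∀ i, AddCommGroup (G i)] [∀ i, Module A (G i)]
    (f : ∀ i j, i ≤ j → G i →ₗ[A] G j) [DirectedSystem G (fun i j h => f i j h)],
    (∀ i, C (ModuleCat.of A (G i))) → C (ModuleCat.of A (Module.DirectLimit G f))

/-- A definable subcategory: a class of modules (closed under isomorphism) which is closed
under direct products, colimits of directed systems, and pure submodules. -/
def IsDefinable (C : ModuleCat.{u} A → Prop) : Prop :=
  ProdClosed A C ∧ DirLimClosed A C ∧ PureSubClosed A C

end Defs


/-- A homomorphism into `ℚ/ℤ` that vanishes on the kernel of `j` extends along `j`. -/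
lemma exists_ratCircle_extension {X Y : Type*} [AddCommGroup X] [AddCommGroup Y] (j : X →+ Y)
    (e : X →+ RatCircle) (h : ∀ x, j x = 0 → e x = 0) :
    ∃ φ : Y →+ RatCircle, ∀ x, φ (j x) = e x := by
  obtain ⟨φ, hφ⟩ := (Module.Baer.of_divisible RatCircle).extension_property_addMonoidHom
    (QuotientAddGroup.kerLift j) (QuotientAddGroup.kerLift_injective j)
    (QuotientAddGroup.lift j.ker e h)
  exact ⟨φ, fun x => DFunLike.congr_fun hφ (x : X ⧸ j.ker)⟩

section PureExact

variable {R : Type u} [Ring R] {L M N : Type u} [AddCommGroup L] [AddCommGroup M]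
  [AddCommGroup N] [Module R L] [Module R M] [Module R N]

lemma IsPureEmbedding.exists_solution {i : L →ₗ[R] M} (hi : IsPureEmbedding R i)
    {α β : Type*} (s : Finset α) (t : Finset β) (r : α → β → R) (l : α → L) (x : β → M)
    (hx : ∀ a ∈ s, ∑ b ∈ t, r a b • x b = i (l a)) :
    ∃ y : β → L, ∀ a ∈ s, ∑ b ∈ t, r a b • y b = l a := by
  classical
  obtain ⟨y, hy⟩ := hi.2 s.card t.card
    (fun j k => r (s.equivFin.symm j) (t.equivFin.symm k)) (fun j => l (s.equivFin.symm j))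
    ⟨fun k => x (t.equivFin.symm k), fun j => by
      rw [← hx _ (s.equivFin.symm j).2, ← Finset.sum_coe_sort t]
      exact Equiv.sum_comp t.equivFin.symm
        (fun b : t => r (s.equivFin.symm j) b • x b)⟩
  refine ⟨fun b => if hb : b ∈ t then y (t.equivFin ⟨b, hb⟩) else 0, fun a ha => ?_⟩
  have h := hy (s.equivFin ⟨a, ha⟩)
  simp only [Equiv.symm_apply_apply] at h
  rw [← h, ← Finset.sum_coe_sort t, ← Equiv.sum_comp t.equivFin]
  simp

namespace Character

lemma add_apply (f g : Character M) (m : M) : (f + g) m = f m + g m := rfl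

/-- Evaluation at a point, as a homomorphism on the character module. -/
def evalHom (m : M) : Character M →+ RatCircle where
  toFun f := f m
  map_zero' := rfl
  map_add' _ _ := rfl

/-- The map of character modules induced by a linear map. -/
def dual (i : L →ₗ[R] M) : Character M →ₗ[Rᵐᵒᵖ] Character L where
  toFun f := ((f : M →+ RatCircle).comp i.toAddMonoidHom : L →+ RatCircle)
  map_add' _ _ := rfl
  map_smul' r f := ext fun l => congrArg f (i.map_smul r.unop l).symm

lemma dual_apply (i : L →ₗ[R] M) (f : Character M) (l : L) : dual i f l = f (i l) := rfl

/-- The pairing of a formal sum of characters of `L` with coefficients in `L`. -/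
def pairing : (Character L →₀ L) →+ RatCircle :=
  Finsupp.liftAddHom fun f => (f : L →+ RatCircle)

/-- The right linear relations between characters of `L`. -/
abbrev Relations (R L : Type u) [Ring R] [AddCommGroup L] [Module R L] : Type u :=
  {c : Character L →₀ R // (c.sum fun f r => op r • f) = 0}

/-- The map sending a relation `c` with coefficient `m` to the formal sum with coefficients
`c f • m`. -/
def relationsHom (R L M : Type u) [Ring R] [AddCommGroup L] [Module R L] [AddCommGroup M]
    [Module R M] : (Relations R L →₀ M) →+ (Character L →₀ M) :=
  Finsupp.liftAddHom fun c =>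
    { toFun m := c.1.mapRange (fun r => r • m) (zero_smul R m)
      map_zero' := by ext; simp
      map_add' m m' := by ext; simp }

lemma relationsHom_single (c : Relations R L) (m : M) :
    relationsHom R L M (Finsupp.single c m) =
      c.1.mapRange (fun r => r • m) (zero_smul R m) :=
  Finsupp.liftAddHom_apply_single _ c m

lemma relationsHom_apply (w : Relations R L →₀ M) (f : Character L) :
    relationsHom R L M w f = ∑ c ∈ w.support, c.1 f • w c := by
  simp [relationsHom, Finsupp.sum, Finsupp.finsetSum_apply]

lemma pairing_eq_zero {i : L →ₗ[R] M} (hi : IsPureEmbedding R i) (a : Character L →₀ L)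
    (w : Relations R L →₀ M)
    (h : a.mapRange i (map_zero i) = relationsHom R L M w) : pairing a = 0 := by
  classical
  set T : Finset (Character L) := a.support ∪ w.support.biUnion fun c => c.1.support
  obtain ⟨y, hy⟩ := hi.exists_solution T w.support (fun f c => c.1 f) a w fun f _ => by
    rw [← relationsHom_apply, ← h, Finsupp.mapRange_apply]
  have hrel : ∀ c ∈ w.support, ∑ f ∈ T, f (c.1 f • y c) = 0 := by
    intro c hc
    have hsub : c.1.support ⊆ T :=
      (Finset.subset_biUnion_of_mem (fun c : Relations R L => c.1.support) hc).trans
        Finset.subset_union_right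
    have hsum := c.2
    rw [Finsupp.sum_of_support_subset _ hsub _ (by simp)] at hsum
    have := congrArg (evalHom (y c)) hsum
    rwa [map_sum, map_zero] at this
  calc pairing a = ∑ f ∈ T, f (a f) :=
        Finsupp.sum_of_support_subset a Finset.subset_union_left
          (fun (f : Character L) l => f l) fun f _ => map_zero f
    _ = ∑ f ∈ T, ∑ c ∈ w.support, f (c.1 f • y c) :=
        Finset.sum_congr rfl fun f hf => by rw [← hy f hf, map_sum]
    _ = 0 := by rw [Finset.sum_comm]; exact Finset.sum_eq_zero hrel

/-- The map of character modules induced by a pure embedding is a split epimorphism. -/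
theorem exists_dual_section {i : L →ₗ[R] M} (hi : IsPureEmbedding R i) :
    ∃ s : Character L →ₗ[Rᵐᵒᵖ] Character M, (dual i).comp s = LinearMap.id := by
  classical
  obtain ⟨φ, hφ⟩ := exists_ratCircle_extension
    ((Finsupp.mapRange.addMonoidHom i.toAddMonoidHom).coprod (-relationsHom R L M))
    ((pairing (L := L)).comp (AddMonoidHom.fst (Character L →₀ L) (Relations R L →₀ M)))
    fun x hx => pairing_eq_zero hi x.1 x.2 <| by
      rw [AddMonoidHom.coprod_apply, AddMonoidHom.neg_apply, ← sub_eq_add_neg, sub_eq_zero] at hx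
      exact hx
  have hrel (c : Character L →₀ R) (hc : (c.sum fun f r => op r • f) = 0) (m : M) :
      φ (c.mapRange (fun r => r • m) (zero_smul R m)) = 0 := by
    have := hφ (0, Finsupp.single ⟨c, hc⟩ m)
    simpa [relationsHom_single] using this
  have hpair (f : Character L) (l : L) : φ (Finsupp.single f (i l)) = f l := by
    have := hφ (Finsupp.single f l, 0)
    simp only [AddMonoidHom.coprod_apply, map_zero, add_zero, AddMonoidHom.comp_apply,
      Finsupp.mapRange.addMonoidHom_apply, Finsupp.mapRange_single] at this
    exact this.trans (Finsupp.liftAddHom_apply_single _ f l)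
  have hsum (c : Character L →₀ R) (f : Character L) (r : R) :
      ((c + Finsupp.single f r).sum fun f r => op r • f) =
        (c.sum fun f r => op r • f) + op r • f := by
    rw [Finsupp.sum_add_index' (by simp) (by simp [add_smul]), Finsupp.sum_single_index (by simp)]
  have hrange (c : Character L →₀ R) (f : Character L) (r : R) (m : M) :
      (c + Finsupp.single f r).mapRange (fun r => r • m) (zero_smul R m) =
        c.mapRange (fun r => r • m) (zero_smul R m) + Finsupp.single f (r • m) := by
    rw [Finsupp.mapRange_add (fun _ _ => add_smul _ _ _), Finsupp.mapRange_single]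
  refine ⟨{ toFun f := (φ.comp (Finsupp.singleAddHom f) : M →+ RatCircle)
            map_add' f g := ext fun m => ?_
            map_smul' r f := ext fun m => ?_ }, ?_⟩
  · have := hrel (0 + .single f 1 + .single g 1 + .single (f + g) (-1))
      (by simp only [hsum]; simp; abel) m
    simp only [hrange] at this
    simp only [Finsupp.mapRange_zero, map_add, zero_add, one_smul, neg_smul,
      Finsupp.single_neg, map_neg, add_neg_eq_zero] at this
    exact this.symm
  · have := hrel (0 + .single (r • f) 1 + .single f (-r.unop))
      (by simp only [hsum]; simp) m
    simp only [hrange] at this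
    simp only [Finsupp.mapRange_zero, map_add, zero_add, one_smul, neg_smul,
      Finsupp.single_neg, map_neg, add_neg_eq_zero] at this
    exact this
  · exact LinearMap.ext fun f => ext fun l => hpair f l

/-- A pure-exact sequence induces a decomposition of the character module of its middle term. -/
theorem nonempty_prod_equiv {i : L →ₗ[R] M} {p : M →ₗ[R] N} (hi : IsPureEmbedding R i)
    (hp : Function.Surjective p) (hexact : LinearMap.range i = LinearMap.ker p) :
    Nonempty ((Character L × Character N) ≃ₗ[Rᵐᵒᵖ] Character M) := by
  obtain ⟨s, hs⟩ := exists_dual_section hi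
  have hs' (f : Character L) (l : L) : s f (i l) = f l :=
    DFunLike.congr_fun (LinearMap.congr_fun hs f) l
  have hpi (l : L) : p (i l) = 0 :=
    LinearMap.mem_ker.1 (hexact ▸ LinearMap.mem_range_self i l)
  refine ⟨LinearEquiv.ofBijective (s.coprod (dual p)) ⟨?_, fun g => ?_⟩⟩
  · rw [injective_iff_map_eq_zero]
    rintro ⟨f, h⟩ hfh
    rw [LinearMap.coprod_apply] at hfh
    obtain rfl : f = 0 := ext fun l => by
      have := DFunLike.congr_fun hfh (i l)
      rwa [add_apply, hs', dual_apply, hpi, map_zero, add_zero] at this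
    obtain rfl : h = 0 := ext fun n => by
      obtain ⟨m, rfl⟩ := hp n
      have := DFunLike.congr_fun hfh m
      rwa [map_zero, zero_add] at this
    rfl
  · obtain ⟨h, hh⟩ := exists_ratCircle_extension p.toAddMonoidHom
      (g - s (dual i g) : Character M) fun m hm => by
        obtain ⟨l, rfl⟩ : m ∈ LinearMap.range i := hexact ▸ LinearMap.mem_ker.2 hm
        exact sub_eq_zero.2 (hs' (dual i g) l).symm
    refine ⟨(dual i g, h), ext fun m => ?_⟩
    rw [LinearMap.coprod_apply, add_apply]
    exact (congrArg (s (dual i g) m + ·) (hh m)).trans (add_sub_cancel _ _)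

end Character

end PureExact

/-- A binary product is linearly equivalent to the corresponding product over `ULift Bool`. -/
def piULiftBoolEquivProd {A : Type u} [Ring A] (F : ULift.{u} Bool → ModuleCat.{u} A) :
    (∀ b, (F b : Type u)) ≃ₗ[A] ((F ⟨true⟩ : Type u) × (F ⟨false⟩ : Type u)) where
  toFun x := (x ⟨true⟩, x ⟨false⟩)
  invFun x
    | ⟨true⟩ => x.1
    | ⟨false⟩ => x.2
  left_inv x := by ext ⟨_ | _⟩ <;> rfl
  right_inv _ := rfl
  map_add' _ _ := rfl
  map_smul' _ _ := rfl

theorem almost_dual_pair_pure_exact_two_out_of_three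
    {R : Type u} [Ring R] (P : ModuleCat.{u} Rᵐᵒᵖ → Prop)
    (hiso : ∀ (N N' : ModuleCat.{u} Rᵐᵒᵖ), P N → ((N : Type u) ≃ₗ[Rᵐᵒᵖ] (N' : Type u)) → P N')
    (hprod : ∀ (ι : Type u) [Fintype ι] (f : ι → ModuleCat.{u} Rᵐᵒᵖ),
      (∀ i, P (f i)) → P (ModuleCat.of Rᵐᵒᵖ (∀ i, (f i : Type u))))
    (hsummand : ∀ (N N' : ModuleCat.{u} Rᵐᵒᵖ), P N' →
      IsDirectSummand Rᵐᵒᵖ (N : Type u) (N' : Type u) → P N)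
    (L M N : Type u) [AddCommGroup L] [AddCommGroup M] [AddCommGroup N]
    [Module R L] [Module R M] [Module R N]
    (i : L →ₗ[R] M) (p : M →ₗ[R] N)
    (hi : IsPureEmbedding R i) (hp : Function.Surjective p)
    (hexact : LinearMap.range i = LinearMap.ker p) :
    P (ModuleCat.of Rᵐᵒᵖ (Character M)) ↔
      P (ModuleCat.of Rᵐᵒᵖ (Character L)) ∧ P (ModuleCat.of Rᵐᵒᵖ (Character N)) := by
  obtain ⟨e⟩ := Character.nonempty_prod_equiv hi hp hexact
  refine ⟨fun hM => ?_, fun ⟨hL, hN⟩ => ?_⟩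
  · have hLN := hiso _ (ModuleCat.of Rᵐᵒᵖ (Character L × Character N)) hM e.symm
    exact ⟨hsummand _ _ hLN ⟨LinearMap.inl _ _ _, LinearMap.fst _ _ _, LinearMap.fst_comp_inl ..⟩,
      hsummand _ _ hLN ⟨LinearMap.inr _ _ _, LinearMap.snd _ _ _, LinearMap.snd_comp_inr ..⟩⟩
  · let F : ULift.{u} Bool → ModuleCat.{u} Rᵐᵒᵖ := fun b =>
      cond b.down (ModuleCat.of Rᵐᵒᵖ (Character L)) (ModuleCat.of Rᵐᵒᵖ (Character N))
    refine hiso _ _ (hprod _ F ?_) ((piULiftBoolEquivProd F).trans e)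
    rintro ⟨_ | _⟩
    exacts [hN, hL]

end
end

section
/- Let R be a ring, let P be a class of right R-modules closed under isomorphism, arbitrary direct products and direct summands, and let S be the class of left R-modules M whose character module M* belongs to P. Then S is closed under direct summands, arbitrary direct sums, and colimits of directed systems: if (M_i, f_ij) is a directed system of left R-modules all lying in S, then its colimit lies in S. -/
universe u

open MulOpposite DirectSum

noncomputable section

namespace Character

section Functoriality

variable {R : Type u} [Ring R]

/-- Precomposition with a linear map, as a map of character modules. -/
def precomp {M N : Type u} [AddCommGroup M] [AddCommGroup N] [Module R M] [Module R N]
    (g : M →ₗ[R] N) : Character N →ₗ[Rᵐᵒᵖ] Character M where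
  toFun f := (f : N →+ RatCircle).comp g.toAddMonoidHom
  map_add' _ _ := rfl
  map_smul' r f := ext fun m => congrArg f (g.map_smul r.unop m).symm

lemma precomp_apply {M N : Type u} [AddCommGroup M] [AddCommGroup N] [Module R M] [Module R N]
    (g : M →ₗ[R] N) (f : Character N) (m : M) : precomp g f m = f (g m) := rfl

lemma isDirectSummand {M N : Type u} [AddCommGroup M] [AddCommGroup N] [Module R M] [Module R N]
    (h : IsDirectSummand R M N) : IsDirectSummand Rᵐᵒᵖ (Character M) (Character N) := by
  obtain ⟨i, p, hip⟩ := h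
  refine ⟨precomp p, precomp i, LinearMap.ext fun f => ext fun m => ?_⟩
  exact congrArg f (LinearMap.congr_fun hip m)

lemma directSum_ext {ι : Type u} {G : ι → Type u} [∀ i, AddCommGroup (G i)]
    [DecidableEq ι] {φ ψ : Character (⨁ i, G i)}
    (h : ∀ i x, φ (DirectSum.of G i x) = ψ (DirectSum.of G i x)) : φ = ψ :=
  DirectSum.addHom_ext h

/-- The character of a direct sum given by a family of characters. -/
def directSumDesc {ι : Type u} {G : ι → Type u} [∀ i, AddCommGroup (G i)]
    [DecidableEq ι] (φ : ∀ i, Character (G i)) : Character (⨁ i, G i) :=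
  DirectSum.toAddMonoid (fun i => (φ i : G i →+ RatCircle))

lemma directSumDesc_of {ι : Type u} {G : ι → Type u} [∀ i, AddCommGroup (G i)]
    [DecidableEq ι] (φ : ∀ i, Character (G i)) (i : ι) (x : G i) :
    directSumDesc φ (DirectSum.of G i x) = φ i x :=
  DirectSum.toAddMonoid_of (fun i => (φ i : G i →+ RatCircle)) i x

/-- `directSumDesc` as a linear map. -/
def directSumDescLinearMap {ι : Type u} (G : ι → Type u) [∀ i, AddCommGroup (G i)]
    [∀ i, Module R (G i)] [DecidableEq ι] :
    (∀ i, Character (G i)) →ₗ[Rᵐᵒᵖ] Character (⨁ i, G i) where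
  toFun := directSumDesc
  map_add' φ ψ := directSum_ext fun i x => by
    refine (directSumDesc_of _ i x).trans ?_
    exact (congrArg₂ (· + ·) (directSumDesc_of φ i x) (directSumDesc_of ψ i x)).symm
  map_smul' r φ := directSum_ext fun i x => by
    refine (directSumDesc_of _ i x).trans ?_
    rw [RingHom.id_apply, smul_right_apply, ← DirectSum.lof_eq_of R, ← LinearMap.map_smul,
      DirectSum.lof_eq_of, directSumDesc_of]
    rfl

lemma isDirectSummand_directSum {ι : Type u} (G : ι → Type u) [∀ i, AddCommGroup (G i)]
    [∀ i, Module R (G i)] :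
    IsDirectSummand Rᵐᵒᵖ (Character (⨁ i, G i)) (∀ i, Character (G i)) := by
  classical
  exact ⟨LinearMap.pi fun i => precomp (DirectSum.lof R ι G i), directSumDescLinearMap G,
    LinearMap.ext fun f => directSum_ext fun i x => directSumDesc_of _ i x⟩

end Functoriality

section DirectLimit

/-- A generalized limit along a proper filter for families in `ℚ/ℤ`, which exists because
`ℚ/ℤ` is an injective abelian group. -/
lemma exists_generalizedLimit {ι : Type u} (l : Filter ι) [l.NeBot] :
    ∃ L : (ι → RatCircle) →+ RatCircle,
      (∀ c, L (fun _ => c) = c) ∧ ∀ a, (∀ᶠ i in l, a i = 0) → L a = 0 := by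
  let const : RatCircle →+ l.Germ RatCircle :=
    { toFun := fun c => (c : l.Germ RatCircle), map_zero' := rfl, map_add' := fun _ _ => rfl }
  have hconst : Function.Injective const.toIntLinearMap :=
    fun _ _ h => Filter.Germ.const_inj.mp h
  obtain ⟨r, hr⟩ := CharacterModule.dual_surjective_of_injective const.toIntLinearMap hconst
    (AddMonoidHom.id RatCircle : CharacterModule RatCircle)
  refine ⟨(r : l.Germ RatCircle →+ RatCircle).comp (Filter.Germ.coeAddHom l),
    fun c => DFunLike.congr_fun hr c, fun a ha => ?_⟩
  have h : (a : l.Germ RatCircle) = ((0 : ι → RatCircle) : l.Germ RatCircle) :=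
    Filter.Germ.coe_eq.mpr ha
  exact (congrArg r h).trans (map_zero r)

variable {R : Type u} [Ring R] {ι : Type u} (G : ι → Type u) [∀ i, AddCommGroup (G i)]
  [∀ i, Module R (G i)]

variable (R) in
/-- The submodule of families that vanish eventually along a filter. -/
def eventuallyZero (l : Filter ι) : Submodule R (∀ i, G i) where
  carrier := {x | ∀ᶠ i in l, x i = 0}
  zero_mem' := Filter.Eventually.of_forall fun _ => rfl
  add_mem' hx hy := by
    filter_upwards [hx, hy] with i hi hj
    rw [Pi.add_apply, hi, hj, add_zero]
  smul_mem' r x hx := by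
    filter_upwards [hx] with i hi
    rw [Pi.smul_apply, hi, smul_zero]

/-- A generalized limit turns a family of characters into a character of the reduced product. -/
def reducedProduct {l : Filter ι} (L : (ι → RatCircle) →+ RatCircle)
    (hL : ∀ a, (∀ᶠ i in l, a i = 0) → L a = 0) :
    (∀ i, Character (G i)) →ₗ[Rᵐᵒᵖ] Character ((∀ i, G i) ⧸ eventuallyZero R G l) where
  toFun φ := QuotientAddGroup.lift (eventuallyZero R G l).toAddSubgroup
    (L.comp (AddMonoidHom.mk' (fun x i => φ i (x i)) fun x y => funext fun i =>
      map_add (φ i) (x i) (y i)))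
    (fun x hx => hL _ (Filter.Eventually.mono hx fun i hi => by
      show φ i (x i) = 0
      rw [hi, map_zero]))
  map_add' φ ψ := ext fun x => by
    obtain ⟨x, rfl⟩ := Submodule.mkQ_surjective _ x
    exact L.map_add (fun i => φ i (x i)) (fun i => ψ i (x i))
  map_smul' r φ := ext fun x => by
    obtain ⟨x, rfl⟩ := Submodule.mkQ_surjective _ x
    rfl

lemma reducedProduct_mkQ {l : Filter ι} (L : (ι → RatCircle) →+ RatCircle)
    (hL : ∀ a, (∀ᶠ i in l, a i = 0) → L a = 0) (φ : ∀ i, Character (G i)) (x : ∀ i, G i) :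
    reducedProduct (R := R) G L hL φ ((eventuallyZero R G l).mkQ x) = L fun i => φ i (x i) := rfl

variable [Preorder ι] (f : ∀ i j, i ≤ j → G i →ₗ[R] G j)

open Classical in
/-- The family of images of an element of `G i`, extended by zero. -/
def images (i : ι) : G i →ₗ[R] ∀ j, G j :=
  LinearMap.pi fun j => if h : i ≤ j then f i j h else 0

lemma images_apply {i j : ι} (h : i ≤ j) (x : G i) : images G f i x j = f i j h x := by
  simp [images, h]

variable [DecidableEq ι]

/-- The direct limit maps to the product reduced modulo eventually zero families. -/
def toReducedProduct [DirectedSystem G (fun i j h => f i j h)] :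
    Module.DirectLimit G f →ₗ[R] (∀ i, G i) ⧸ eventuallyZero R G Filter.atTop :=
  Module.DirectLimit.lift R ι G f (fun i => (Submodule.mkQ _).comp (images G f i))
    fun i j hij x => by
      refine (Submodule.Quotient.eq _).mpr ?_
      filter_upwards [Filter.eventually_ge_atTop j] with k hk
      rw [Pi.sub_apply, images_apply G f hk, images_apply G f (hij.trans hk), sub_eq_zero]
      exact DirectedSystem.map_map (f := fun i j h => f i j h) hij hk x

lemma toReducedProduct_of [DirectedSystem G (fun i j h => f i j h)] (i : ι) (x : G i) :
    toReducedProduct G f (Module.DirectLimit.of R ι G f i x) =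
      (eventuallyZero R G Filter.atTop).mkQ (images G f i x) :=
  Module.DirectLimit.lift_of _ _ x

lemma isDirectSummand_directLimit [IsDirected ι (· ≤ ·)] [Nonempty ι]
    [DirectedSystem G (fun i j h => f i j h)] :
    IsDirectSummand Rᵐᵒᵖ (Character (Module.DirectLimit G f)) (∀ i, Character (G i)) := by
  obtain ⟨L, hconst, hL⟩ := exists_generalizedLimit (Filter.atTop : Filter ι)
  refine ⟨LinearMap.pi fun i => precomp (Module.DirectLimit.of R ι G f i),
    (precomp (toReducedProduct G f)).comp (reducedProduct G L hL),
    LinearMap.ext fun φ => ext fun x => ?_⟩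
  induction x using Module.DirectLimit.induction_on with
  | ih i x =>
    rw [LinearMap.comp_apply, LinearMap.comp_apply, precomp_apply,
      toReducedProduct_of, reducedProduct_mkQ]
    refine Eq.trans ?_ (hconst _)
    rw [← sub_eq_zero, ← map_sub]
    refine hL _ ?_
    filter_upwards [Filter.eventually_ge_atTop i] with j hij
    rw [Pi.sub_apply, LinearMap.pi_apply, precomp_apply, images_apply G f hij,
      Module.DirectLimit.of_f, LinearMap.id_apply, sub_self]

end DirectLimit

end Character

theorem almost_dual_pair_S_closed_summands_sums_directLimits
    {R : Type u} [Ring R] (P : ModuleCat.{u} Rᵐᵒᵖ → Prop)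
    (hiso : ∀ (N N' : ModuleCat.{u} Rᵐᵒᵖ), P N → ((N : Type u) ≃ₗ[Rᵐᵒᵖ] (N' : Type u)) → P N')
    (hprod : ProdClosed Rᵐᵒᵖ P)
    (hsummand : ∀ (N N' : ModuleCat.{u} Rᵐᵒᵖ), P N' →
      IsDirectSummand Rᵐᵒᵖ (N : Type u) (N' : Type u) → P N) :
    (∀ (M M' : Type u) [AddCommGroup M] [AddCommGroup M'] [Module R M] [Module R M'],
      IsDirectSummand R M M' → P (ModuleCat.of Rᵐᵒᵖ (Character M')) →
        P (ModuleCat.of Rᵐᵒᵖ (Character M))) ∧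
    (∀ (ι : Type u) (f : ι → ModuleCat.{u} R),
      (∀ i, P (ModuleCat.of Rᵐᵒᵖ (Character (f i : Type u)))) →
        P (ModuleCat.of Rᵐᵒᵖ (Character (⨁ i, (f i : Type u))))) ∧
    (∀ (ι : Type u) [Preorder ι] [IsDirected ι (· ≤ ·)] [Nonempty ι] [DecidableEq ι]
      (G : ι → Type u) [∀ i, AddCommGroup (G i)] [∀ i, Module R (G i)]
      (f : ∀ i j, i ≤ j → G i →ₗ[R] G j) [DirectedSystem G (fun i j h => f i j h)],
      (∀ i, P (ModuleCat.of Rᵐᵒᵖ (Character (G i)))) →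
        P (ModuleCat.of Rᵐᵒᵖ (Character (Module.DirectLimit G f)))) := by
  refine ⟨fun M M' _ _ _ _ h hM' => hsummand _ _ hM' (Character.isDirectSummand h),
    fun ι f hf => ?_, fun ι _ _ _ _ G _ _ f _ hG => ?_⟩
  · exact hsummand _ _ (hprod ι _ hf) (Character.isDirectSummand_directSum fun i => (f i : Type u))
  · exact hsummand _ _ (hprod ι _ hG) (Character.isDirectSummand_directLimit G f)

end
end

section
/- Let R be a ring, let P be a class of right R-modules closed under isomorphism, arbitrary direct products and direct summands, and let S be the class of left R-modules M whose character module M* belongs to P. Then S is precovering in the category of left R-modules: for every left R-module M there exist A ∈ S and an R-linear map φ : A → M such that every R-linear map A' → M with A' ∈ S factors through φ. -/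
universe u

open MulOpposite DirectSum

noncomputable section

/-- Purity of an embedding in terms of systems indexed by arbitrary finite types. -/
lemma IsPureEmbedding.exists_solution_s2 {A : Type u} [Ring A] {L M : Type u} [AddCommGroup L]
    [AddCommGroup M] [Module A L] [Module A M] {i : L →ₗ[A] M} (hi : IsPureEmbedding A i)
    {ι κ : Type*} [Fintype ι] [Fintype κ] (r : ι → κ → A) (l : ι → L) (x : κ → M)
    (hx : ∀ j, ∑ k, r j k • x k = i (l j)) : ∃ y : κ → L, ∀ j, ∑ k, r j k • y k = l j := by
  let e := Fintype.equivFin ι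
  let e' := Fintype.equivFin κ
  obtain ⟨y, hy⟩ := hi.2 _ _ (fun j k => r (e.symm j) (e'.symm k)) (fun j => l (e.symm j))
    ⟨fun k => x (e'.symm k), fun j => by
      rw [← hx]
      exact e'.symm.sum_comp (fun k => r (e.symm j) k • x k)⟩
  refine ⟨fun k => y (e' k), fun j => ?_⟩
  have h := hy (e j)
  simp only [Equiv.symm_apply_apply] at h
  rw [← h, ← e'.sum_comp]
  simp

/-- `ℚ/ℤ` is injective: a character killing the kernel of `j` extends along `j`. -/
lemma exists_addMonoidHom_comp_eq {B C : Type u} [AddCommGroup B] [AddCommGroup C] (j : B →+ C)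
    (f : B →+ RatCircle) (h : ∀ b, j b = 0 → f b = 0) :
    ∃ F : C →+ RatCircle, ∀ b, F (j b) = f b := by
  have hle : j.ker ≤ f.ker := fun b hb => h b hb
  obtain ⟨F, hF⟩ := CharacterModule.dual_surjective_of_injective (R := ℤ)
    (QuotientAddGroup.kerLift j).toIntLinearMap (QuotientAddGroup.kerLift_injective j)
    (QuotientAddGroup.lift j.ker f hle)
  exact ⟨F, fun b => DFunLike.congr_fun hF (b : B ⧸ j.ker)⟩

namespace Character

variable {R : Type u} [Ring R]

/-- Precomposition with a linear map, as a map of character modules. -/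
def map {M N : Type u} [AddCommGroup M] [Module R M] [AddCommGroup N] [Module R N]
    (f : M →ₗ[R] N) : Character N →ₗ[Rᵐᵒᵖ] Character M where
  toFun c := ((c : N →+ RatCircle).comp f.toAddMonoidHom : M →+ RatCircle)
  map_add' _ _ := rfl
  map_smul' r c := ext fun m => (congrArg c (f.map_smul r.unop m)).symm

lemma map_apply {M N : Type u} [AddCommGroup M] [Module R M] [AddCommGroup N] [Module R N]
    (f : M →ₗ[R] N) (c : Character N) (m : M) : map f c m = c (f m) := rfl

lemma sum_apply {M : Type u} [AddCommGroup M] {ι : Type*} (s : Finset ι) (f : ι → Character M)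
    (m : M) : (∑ i ∈ s, f i) m = ∑ i ∈ s, f i m :=
  AddMonoidHom.finsetSum_apply f s m

/-- The additive map `⊕_K F → ⊕_J F` attached to a family of columns `c : K → (J →₀ R)`. -/
def columnMap {J K F : Type u} [AddCommGroup F] [Module R F] (c : K → J →₀ R) :
    (K →₀ F) →+ (J →₀ F) :=
  Finsupp.liftAddHom fun k =>
    { toFun := fun x => (c k).mapRange (· • x) (zero_smul R x)
      map_zero' := by ext; simp
      map_add' := fun x y => by ext; simp }

lemma columnMap_apply {J K F : Type u} [AddCommGroup F] [Module R F] (c : K → J →₀ R)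
    (e : K →₀ F) (j : J) : columnMap c e j = ∑ k ∈ e.support, c k j • e k := by
  simp [columnMap, Finsupp.sum, Finsupp.finsetSum_apply]

lemma columnMap_single {J K F : Type u} [AddCommGroup F] [Module R F] (c : K → J →₀ R)
    (k : K) (x : F) : columnMap c (Finsupp.single k x) = (c k).mapRange (· • x) (zero_smul R x) := by
  rw [columnMap, Finsupp.liftAddHom_apply_single]
  rfl

/-- The linear relations holding in the right module of characters of `L`. -/
abbrev Relation (R : Type u) [Ring R] (L : Type u) [AddCommGroup L] [Module R L] : Type u :=
  {ρ : Character L →₀ R // (ρ.sum fun c a => op a • c) = 0}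

/-- Evaluation `⊕_{L*} L → ℚ/ℤ`. -/
def evalSum (L : Type u) [AddCommGroup L] : (Character L →₀ L) →+ RatCircle :=
  Finsupp.liftAddHom fun c => (c : L →+ RatCircle)

/-- A pure embedding induces an injection on tensor products with `L*`, expressed by generators
and relations and tested against evaluation. -/
lemma evalSum_eq_zero {L F : Type u} [AddCommGroup L] [Module R L] [AddCommGroup F] [Module R F]
    {i : L →ₗ[R] F} (hi : IsPureEmbedding R i) (h : Character L →₀ L)
    (e : Relation R L →₀ F)
    (he : columnMap (fun ρ : Relation R L => ρ.1) e =
      Finsupp.mapRange.addMonoidHom i.toAddMonoidHom h) :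
    evalSum L h = 0 := by
  classical
  let s : Finset (Character L) := h.support ∪ e.support.biUnion fun ρ => ρ.1.support
  obtain ⟨y, hy⟩ := hi.exists_solution_s2 (ι := s) (κ := e.support) (fun c ρ => ρ.1.1 c.1)
    (fun c => h c.1) (fun ρ => e ρ.1) (fun c => by
      have := DFunLike.congr_fun he c.1
      rw [columnMap_apply] at this
      rw [Finset.sum_coe_sort e.support (fun ρ => ρ.1 c.1 • e ρ), this]
      rfl)
  have h1 : evalSum L h = ∑ c : s, c.1 (h c.1) := by
    rw [Finset.sum_coe_sort s (fun c => c (h c))]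
    change h.sum (fun c x => c x) = _
    exact Finsupp.sum_of_support_subset h Finset.subset_union_left _ fun c _ => map_zero c
  rw [h1]
  calc ∑ c : s, c.1 (h c.1) = ∑ c : s, ∑ ρ : e.support, (op (ρ.1.1 c.1) • c.1) (y ρ) :=
        Finset.sum_congr rfl fun c _ => by
          rw [← hy c, map_sum]
          rfl
    _ = ∑ ρ : e.support, (∑ c : s, op (ρ.1.1 c.1) • c.1) (y ρ) := by
        rw [Finset.sum_comm]
        exact Finset.sum_congr rfl fun ρ _ => (sum_apply _ _ _).symm
    _ = 0 := Finset.sum_eq_zero fun ρ _ => by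
        have hρ : ∑ c : s, op (ρ.1.1 c.1) • c.1 = 0 := by
          rw [Finset.sum_coe_sort s (fun c => op (ρ.1.1 c) • c)]
          refine (Finsupp.sum_of_support_subset ρ.1.1 ?_ _ fun c _ => by simp).symm.trans ρ.1.2
          exact (Finset.subset_biUnion_of_mem (fun ρ : Relation R L => ρ.1.support) ρ.2).trans
            Finset.subset_union_right
        rw [hρ]
        rfl

/-- The restriction of characters along a pure embedding has a linear section. -/
lemma exists_section_of_isPureEmbedding {L F : Type u} [AddCommGroup L] [Module R L]
    [AddCommGroup F] [Module R F] {i : L →ₗ[R] F} (hi : IsPureEmbedding R i) :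
    ∃ σ : Character L →ₗ[Rᵐᵒᵖ] Character F, ∀ c, map i (σ c) = c := by
  classical
  let D : (Relation R L →₀ F) →+ (Character L →₀ F) := columnMap fun ρ => ρ.1
  obtain ⟨E, hE⟩ := exists_addMonoidHom_comp_eq
    ((QuotientAddGroup.mk' D.range).comp (Finsupp.mapRange.addMonoidHom i.toAddMonoidHom))
    (evalSum L) fun h hh => by
      obtain ⟨e, he⟩ := (QuotientAddGroup.eq_zero_iff _).1 hh
      exact evalSum_eq_zero hi h e he
  let T : (Character L →₀ F) →+ RatCircle := E.comp (QuotientAddGroup.mk' D.range)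
  have hT (ρ : Relation R L) (x : F) : T (ρ.1.mapRange (· • x) (zero_smul R x)) = 0 := by
    have h0 : QuotientAddGroup.mk' D.range (ρ.1.mapRange (· • x) (zero_smul R x)) = 0 :=
      (QuotientAddGroup.eq_zero_iff _).2
        ⟨Finsupp.single ρ x, columnMap_single (fun ρ : Relation R L => ρ.1) ρ x⟩
    change E _ = 0
    rw [h0, map_zero]
  refine ⟨
    { toFun := fun c => (T.comp (Finsupp.singleAddHom c) : F →+ RatCircle)
      map_add' := fun c d => ext fun x => ?_
      map_smul' := fun r c => ext fun x => ?_ }, fun c => ext fun l => ?_⟩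
  · have h := hT ⟨Finsupp.single (c + d) 1 - Finsupp.single c 1 - Finsupp.single d 1, by
      rw [Finsupp.sum_sub_index (by intros; simp [sub_smul]),
        Finsupp.sum_sub_index (by intros; simp [sub_smul])]
      simp⟩ x
    have h' : (Finsupp.single (c + d) (1 : R) - Finsupp.single c 1
        - Finsupp.single d 1).mapRange (· • x) (zero_smul R x)
        = Finsupp.single (c + d) x - Finsupp.single c x - Finsupp.single d x := by
      rw [Finsupp.mapRange_sub (fun a b => sub_smul a b x),
        Finsupp.mapRange_sub (fun a b => sub_smul a b x)]
      simp
    rw [h', map_sub, map_sub, sub_sub, sub_eq_zero] at h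
    exact h
  · have h := hT ⟨Finsupp.single (r • c) 1 - Finsupp.single c r.unop, by
      rw [Finsupp.sum_sub_index (by intros; simp [sub_smul])]
      simp⟩ x
    have h' : (Finsupp.single (r • c) (1 : R) - Finsupp.single c r.unop).mapRange
        (· • x) (zero_smul R x) = Finsupp.single (r • c) x - Finsupp.single c (r.unop • x) := by
      rw [Finsupp.mapRange_sub (fun a b => sub_smul a b x)]
      simp
    rw [h', map_sub, sub_eq_zero] at h
    exact h
  · have h := hE (Finsupp.single c l)
    have h1 : evalSum L (Finsupp.single c l) = c l := by
      change (Finsupp.single c l).sum (fun c x => c x) = _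
      exact Finsupp.sum_single_index (map_zero c)
    rw [h1] at h
    rw [← h, map_apply]
    change T _ = E (QuotientAddGroup.mk' D.range _)
    rw [Finsupp.mapRange.addMonoidHom_apply, Finsupp.mapRange_single]
    rfl

/-- The character module of a pure quotient is a direct summand. -/
lemma isDirectSummand_quotient {F : Type u} [AddCommGroup F] [Module R F] (L : Submodule R F)
    (hL : IsPureEmbedding R L.subtype) :
    IsDirectSummand Rᵐᵒᵖ (Character (F ⧸ L)) (Character F) := by
  obtain ⟨σ, hσ⟩ := exists_section_of_isPureEmbedding hL
  let τ : Character F →ₗ[Rᵐᵒᵖ] Character F := LinearMap.id - σ.comp (map L.subtype)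
  have hτ (f : Character F) : L.toAddSubgroup ≤ AddMonoidHom.ker (τ f : F →+ RatCircle) := by
    intro l hl
    have h := DFunLike.congr_fun (hσ (map L.subtype f)) (⟨l, hl⟩ : L)
    change f l - σ (map L.subtype f) l = 0
    rw [sub_eq_zero]
    exact h.symm
  refine ⟨map L.mkQ,
    { toFun := fun f => (QuotientAddGroup.lift L.toAddSubgroup (τ f) (hτ f) : _ →+ RatCircle)
      map_add' := fun f g => ext fun q => ?_
      map_smul' := fun r f => ext fun q => ?_ }, LinearMap.ext fun f => ext fun q => ?_⟩
  · obtain ⟨x, rfl⟩ := L.mkQ_surjective q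
    exact DFunLike.congr_fun (τ.map_add f g) x
  · obtain ⟨x, rfl⟩ := L.mkQ_surjective q
    exact DFunLike.congr_fun (τ.map_smul r f) x
  · obtain ⟨x, rfl⟩ := L.mkQ_surjective q
    have h0 : map L.subtype (map L.mkQ f) = 0 := ext fun l => by
      rw [map_apply, map_apply, Submodule.subtype_apply, Submodule.mkQ_apply,
        (Submodule.Quotient.mk_eq_zero L).2 l.2, map_zero]
      rfl
    have h1 : τ (map L.mkQ f) = map L.mkQ f := by
      simp [τ, h0]
    exact DFunLike.congr_fun h1 x

/-- The character module of a direct sum is the product of the character modules. -/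
def directSumEquiv {ι : Type u} (A : ι → Type u) [∀ i, AddCommGroup (A i)] [∀ i, Module R (A i)]
    [DecidableEq ι] : (∀ i, Character (A i)) ≃ₗ[Rᵐᵒᵖ] Character (⨁ i, A i) :=
  LinearEquiv.symm
    { toFun := fun f i => map (DirectSum.lof R ι A i) f
      map_add' := fun _ _ => rfl
      map_smul' := fun r f => funext fun i => (map (DirectSum.lof R ι A i)).map_smul r f
      invFun := fun f => (DirectSum.toAddMonoid (fun i => (f i : A i →+ RatCircle)) : _ →+ _)
      left_inv := fun f => by
        refine DirectSum.addHom_ext (f := (_ : (⨁ i, A i) →+ RatCircle)) fun i x => ?_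
        exact DirectSum.toAddMonoid_of _ i x
      right_inv := fun f => funext fun i => ext fun x => DirectSum.toAddMonoid_of _ i x }

/-- Character modules of linearly equivalent modules are linearly equivalent. -/
def congr {M N : Type u} [AddCommGroup M] [Module R M] [AddCommGroup N] [Module R N]
    (e : M ≃ₗ[R] N) : Character M ≃ₗ[Rᵐᵒᵖ] Character N :=
  LinearEquiv.ofLinearMap (map e.symm.toLinearMap) (map e.toLinearMap)
    (LinearMap.ext fun f => ext fun x => congrArg f (e.apply_symm_apply x))
    (LinearMap.ext fun f => ext fun x => congrArg f (e.symm_apply_apply x))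

end Character

section PureSubmodules

variable {R : Type u} [Ring R]

/-- One-variable terms in the language of `R`-modules with function symbols for solutions of
finite systems of linear equations. -/
inductive PureTerm (R : Type u) : Type u
  | var : PureTerm R
  | add : PureTerm R → PureTerm R → PureTerm R
  | smul : R → PureTerm R → PureTerm R
  | sol {m n : ℕ} : Matrix (Fin m) (Fin n) R → Fin n → (Fin m → PureTerm R) → PureTerm R

/-- Evaluation of a term, given an interpretation of the solution symbols. -/
def PureTerm.eval {F : Type u} [AddCommGroup F] [Module R F]
    (ζ : ∀ {m n : ℕ}, Matrix (Fin m) (Fin n) R → (Fin m → F) → Fin n → F) (x : F) :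
    PureTerm R → F
  | .var => x
  | .add s t => s.eval ζ x + t.eval ζ x
  | .smul a t => a • t.eval ζ x
  | .sol r k t => ζ r (fun j => (t j).eval ζ x) k

/-- A purity criterion for submodules. -/
lemma Submodule.isPureEmbedding_subtype_iff {F : Type u} [AddCommGroup F] [Module R F]
    (L : Submodule R F) : IsPureEmbedding R L.subtype ↔
      ∀ (m n : ℕ) (r : Matrix (Fin m) (Fin n) R) (x : Fin n → F),
        (∀ j, ∑ k, r j k • x k ∈ L) →
        ∃ y : Fin n → F, (∀ k, y k ∈ L) ∧ ∀ j, ∑ k, r j k • y k = ∑ k, r j k • x k := by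
  constructor
  · intro h m n r x hx
    obtain ⟨y, hy⟩ := h.2 m n r (fun j => ⟨_, hx j⟩) ⟨x, fun j => rfl⟩
    refine ⟨fun k => y k, fun k => (y k).2, fun j => ?_⟩
    simpa using congrArg L.subtype (hy j)
  · refine fun h => ⟨L.subtype_injective, fun m n r l ⟨x, hx⟩ => ?_⟩
    obtain ⟨y, hyL, hy⟩ := h m n r x fun j => by rw [hx j]; exact (l j).2
    refine ⟨fun k => ⟨y k, hyL k⟩, fun j => Subtype.ext ?_⟩
    simpa using (hy j).trans (hx j)

lemma exists_solution_mod_range {X Y : Type*} [AddCommGroup X] [AddCommGroup Y] (D : X →+ Y) :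
    ∃ ζ : Y → X, ∀ c c' : Y, c - c' ∈ D.range → D (ζ c) - D (ζ c') = c - c' := by
  have h (c : Y) : ∃ x, D x = c - (c : Y ⧸ D.range).out := by
    have : c - (c : Y ⧸ D.range).out ∈ D.range := by
      rw [← QuotientAddGroup.eq_zero_iff, QuotientAddGroup.mk_sub, sub_eq_zero]
      exact (Quotient.out_eq' _).symm
    exact this
  choose ζ hζ using h
  refine ⟨ζ, fun c c' hc => ?_⟩
  have : (c : Y ⧸ D.range) = c' := by
    rwa [← sub_eq_zero, ← QuotientAddGroup.mk_sub, QuotientAddGroup.eq_zero_iff]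
  rw [hζ, hζ, this]
  abel

/-- If the kernel of `g : F → M` contains no nonzero pure submodule of `F`, then the size of `F`
is bounded in terms of `R` and `M`. -/
lemma exists_injective_of_pure_eq_bot {F M : Type u} [AddCommGroup F] [Module R F]
    [AddCommGroup M] [Module R M] (g : F →ₗ[R] M)
    (hg : ∀ L : Submodule R F, IsPureEmbedding R L.subtype → L ≤ LinearMap.ker g → L = ⊥) :
    ∃ f : F → PureTerm R → M, Function.Injective f := by
  have hsol (m n : ℕ) (r : Matrix (Fin m) (Fin n) R) :
      ∃ ζ : (Fin m → F) → Fin n → F, ∀ (c c' : Fin m → F) (x : Fin n → F),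
        (∀ j, ∑ k, r j k • x k = c j - c' j) →
        ∀ j, ∑ k, r j k • (ζ c k - ζ c' k) = c j - c' j := by
    let D : (Fin n → F) →+ (Fin m → F) :=
      { toFun := fun x j => ∑ k, r j k • x k
        map_zero' := by ext; simp
        map_add' := fun x y => by ext; simp [Finset.sum_add_distrib] }
    obtain ⟨ζ, hζ⟩ := exists_solution_mod_range D
    refine ⟨ζ, fun c c' x hx j => ?_⟩
    have := congrFun (hζ c c' ⟨x, funext hx⟩) j
    simpa [D, smul_sub, Finset.sum_sub_distrib] using this
  choose ζ hζ using hsol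
  let ev : F → PureTerm R → F := PureTerm.eval fun {m n} => ζ m n
  refine ⟨fun x t => g (ev x t), fun x x' hxx' => ?_⟩
  let L : Submodule R F :=
    { carrier := {d | ∃ t, d = ev x t - ev x' t}
      zero_mem' := ⟨.smul 0 .var, by simp [ev, PureTerm.eval]⟩
      add_mem' := by
        rintro _ _ ⟨s, rfl⟩ ⟨t, rfl⟩
        exact ⟨.add s t, by simp only [ev, PureTerm.eval]; abel⟩
      smul_mem' := by
        rintro a _ ⟨t, rfl⟩
        exact ⟨.smul a t, by simp only [ev, PureTerm.eval, smul_sub]⟩ }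
  have hL : L = ⊥ := by
    refine hg L (L.isPureEmbedding_subtype_iff.2 fun m n r z hz => ?_) ?_
    · choose t ht using hz
      refine ⟨fun k => ev x (.sol r k t) - ev x' (.sol r k t), fun k => ⟨_, rfl⟩, fun j => ?_⟩
      rw [ht j]
      exact hζ m n r (fun j => ev x (t j)) (fun j => ev x' (t j)) z ht j
    · rintro _ ⟨t, rfl⟩
      rw [LinearMap.mem_ker, map_sub, sub_eq_zero]
      exact congrFun hxx' t
  have hmem : x - x' ∈ L := ⟨.var, rfl⟩
  rw [hL, Submodule.mem_bot, sub_eq_zero] at hmem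
  exact hmem

/-- The preimage of a pure submodule under a pure quotient map is pure. -/
lemma isPureEmbedding_comap_mkQ {F : Type u} [AddCommGroup F] [Module R F] (L : Submodule R F)
    (hL : IsPureEmbedding R L.subtype) (L' : Submodule R (F ⧸ L))
    (hL' : IsPureEmbedding R L'.subtype) : IsPureEmbedding R (L'.comap L.mkQ).subtype := by
  rw [Submodule.isPureEmbedding_subtype_iff] at hL hL' ⊢
  intro m n r x hx
  obtain ⟨y, hyL, hy⟩ := hL' m n r (fun k => L.mkQ (x k)) fun j => by simpa using hx j
  choose z hz using fun k => L.mkQ_surjective (y k)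
  obtain ⟨w, hwL, hw⟩ := hL m n r (fun k => z k - x k) fun j => by
    rw [← Submodule.Quotient.mk_eq_zero, ← Submodule.mkQ_apply]
    have := hy j
    simp only [← hz] at this
    simp only [map_sum, map_smul, map_sub, smul_sub, Finset.sum_sub_distrib, this, sub_self]
  refine ⟨fun k => z k - w k, fun k => ?_, fun j => ?_⟩
  · have h0 : L.mkQ (w k) = 0 := (Submodule.Quotient.mk_eq_zero L).2 (hwL k)
    rw [Submodule.mem_comap, map_sub, h0, sub_zero, hz]
    exact hyL k
  · have := hw j
    simp only [smul_sub, Finset.sum_sub_distrib] at this ⊢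
    rw [this]
    abel

/-- Unions of nonempty chains of pure submodules are pure. -/
lemma isPureEmbedding_sSup {F : Type u} [AddCommGroup F] [Module R F]
    (c : Set (Submodule R F)) (hc : IsChain (· ≤ ·) c) (hne : c.Nonempty)
    (h : ∀ L ∈ c, IsPureEmbedding R L.subtype) : IsPureEmbedding R (sSup c).subtype := by
  rw [Submodule.isPureEmbedding_subtype_iff]
  intro m n r x hx
  have hdir : DirectedOn (· ≤ ·) c := hc.directedOn
  choose L hLc hL using fun j => (Submodule.mem_sSup_of_directed hne hdir).1 (hx j)
  obtain ⟨N, hNc, hN⟩ : ∃ N ∈ c, ∀ j, L j ≤ N := by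
    have : Nonempty c := hne.to_subtype
    obtain ⟨N, hN⟩ := (directedOn_iff_directed.1 hdir).finite_le fun j => (⟨L j, hLc j⟩ : c)
    exact ⟨N.1, N.2, hN⟩
  obtain ⟨y, hyN, hy⟩ := N.isPureEmbedding_subtype_iff.1 (h N hNc) m n r x fun j => hN j (hL j)
  exact ⟨y, fun k => le_sSup hNc (hyN k), hy⟩

/-- Every linear map factors through a pure quotient of bounded size. -/
lemma exists_pure_le_ker {F M : Type u} [AddCommGroup F] [Module R F]
    [AddCommGroup M] [Module R M] (g : F →ₗ[R] M) :
    ∃ L : Submodule R F, IsPureEmbedding R L.subtype ∧ L ≤ LinearMap.ker g ∧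
      ∃ f : F ⧸ L → PureTerm R → M, Function.Injective f := by
  obtain ⟨L, -, hL⟩ := zorn_le_nonempty₀
    {L : Submodule R F | IsPureEmbedding R L.subtype ∧ L ≤ LinearMap.ker g}
    (fun c hcS hc L₀ hL₀ => ⟨sSup c,
      ⟨isPureEmbedding_sSup c hc ⟨L₀, hL₀⟩ fun L h => (hcS h).1, sSup_le fun L h => (hcS h).2⟩,
      fun L h => le_sSup h⟩)
    ⊥ ⟨(⊥ : Submodule R F).isPureEmbedding_subtype_iff.2 fun m n r x hx =>
      ⟨0, fun k => rfl, fun j => by simpa using ((Submodule.mem_bot R).1 (hx j)).symm⟩, bot_le⟩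
  refine ⟨L, hL.prop.1, hL.prop.2, exists_injective_of_pure_eq_bot (L.liftQ g hL.prop.2) ?_⟩
  intro L' hL' hle
  have hmax : L'.comap L.mkQ ≤ L := hL.le_of_ge
    ⟨isPureEmbedding_comap_mkQ L hL.prop.1 L' hL', fun x hx => hle hx⟩
    fun x hx => by
      rw [Submodule.mem_comap, Submodule.mkQ_apply, (Submodule.Quotient.mk_eq_zero L).2 hx]
      exact L'.zero_mem
  rw [eq_bot_iff]
  intro q hq
  obtain ⟨x, rfl⟩ := L.mkQ_surjective q
  exact (Submodule.Quotient.mk_eq_zero L).2 (hmax hq)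

end PureSubmodules

/-- Modules over `M` whose underlying set is a subset of `X`. -/
structure SubsetOver (R : Type u) [Ring R] (X M : Type u) [AddCommGroup M] [Module R M] where
  /-- The underlying set. -/
  carrier : Set X
  /-- The group structure. -/
  [addCommGroup : AddCommGroup carrier]
  /-- The module structure. -/
  [module : Module R carrier]
  /-- The structure map. -/
  hom : carrier →ₗ[R] M

attribute [instance] SubsetOver.addCommGroup SubsetOver.module

/-- A module over `M` that injects into `X` is isomorphic over `M` to one carried by a subset
of `X`. -/
lemma SubsetOver.exists_linearEquiv {R : Type u} [Ring R] {X M N : Type u} [AddCommGroup M]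
    [Module R M] [AddCommGroup N] [Module R N] (g : N →ₗ[R] M) (f : N → X)
    (hf : Function.Injective f) :
    ∃ (B : SubsetOver R X M) (e : N ≃ₗ[R] B.carrier), ∀ x, B.hom (e x) = g x := by
  let e := (Equiv.ofInjective f hf).symm
  let _ : AddCommGroup (Set.range f) := e.addCommGroup
  let _ : Module R (Set.range f) := e.module R
  let E : Set.range f ≃ₗ[R] N := e.linearEquiv R
  exact ⟨⟨Set.range f, g.comp E.toLinearMap⟩, E.symm, fun x => congrArg g (E.apply_symm_apply x)⟩

theorem almost_dual_pair_S_precovering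
    {R : Type u} [Ring R] (P : ModuleCat.{u} Rᵐᵒᵖ → Prop)
    (hiso : ∀ (N N' : ModuleCat.{u} Rᵐᵒᵖ), P N → ((N : Type u) ≃ₗ[Rᵐᵒᵖ] (N' : Type u)) → P N')
    (hprod : ProdClosed Rᵐᵒᵖ P)
    (hsummand : ∀ (N N' : ModuleCat.{u} Rᵐᵒᵖ), P N' →
      IsDirectSummand Rᵐᵒᵖ (N : Type u) (N' : Type u) → P N) :
    ∀ (M : ModuleCat.{u} R), ∃ (A : ModuleCat.{u} R),
      P (ModuleCat.of Rᵐᵒᵖ (Character (A : Type u))) ∧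
      ∃ φ : (A : Type u) →ₗ[R] (M : Type u),
        ∀ (A' : ModuleCat.{u} R), P (ModuleCat.of Rᵐᵒᵖ (Character (A' : Type u))) →
          ∀ g : (A' : Type u) →ₗ[R] (M : Type u),
            ∃ h : (A' : Type u) →ₗ[R] (A : Type u), φ.comp h = g := by
  classical
  intro M
  let I := {B : SubsetOver R (PureTerm R → M) M // P (ModuleCat.of Rᵐᵒᵖ (Character B.carrier))}
  let A : I → Type u := fun B => B.1.carrier
  refine ⟨ModuleCat.of R (⨁ B, A B),
    hiso _ _ (hprod I (fun B => ModuleCat.of Rᵐᵒᵖ (Character (A B))) fun B => B.2)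
      (Character.directSumEquiv A),
    DirectSum.toModule R I M fun B => B.1.hom, fun A' hA' g => ?_⟩
  obtain ⟨L, hL, hLg, f, hf⟩ := exists_pure_le_ker g
  obtain ⟨B, e, he⟩ := SubsetOver.exists_linearEquiv (L.liftQ g hLg) f hf
  have hB : P (ModuleCat.of Rᵐᵒᵖ (Character B.carrier)) :=
    hiso (ModuleCat.of Rᵐᵒᵖ (Character (A' ⧸ L))) _
      (hsummand _ _ hA' (Character.isDirectSummand_quotient L hL)) (Character.congr e)
  refine ⟨(DirectSum.lof R I A ⟨B, hB⟩).comp (e.toLinearMap.comp L.mkQ),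
    LinearMap.ext fun x => ?_⟩
  exact (DirectSum.toModule_lof R (M := A) (φ := fun B : I => B.1.hom) ⟨B, hB⟩
    (e (L.mkQ x))).trans (he (L.mkQ x))

end
end

section
/- Let R and S be rings, let M be a nonzero left R-module carrying an S-module structure commuting with the R-action, and let E be an injective cogenerator of the category of S-modules. Then the dual right R-module M* = Hom_S(M, E) has an indecomposable direct summand: there exist submodules N, N' of M* with M* the internal direct sum of N and N', and N indecomposable. In particular, for every nonzero left R-module M the character module Hom_ℤ(M, ℚ/ℤ) has an indecomposable direct summand. -/
universe u

open MulOpposite DirectSum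

noncomputable section

section DualMod

variable (S : Type u) [Ring S] (E : Type u) [AddCommGroup E] [Module S E]
variable (M : Type u) [AddCommGroup M] [Module S M]

/-- The dual `Hom_S(M, E)` of `M` with respect to the pair `(S, E)`. -/
def DualMod : Type u := M →ₗ[S] E

instance DualMod.instAddCommGroup : AddCommGroup (DualMod S E M) :=
  inferInstanceAs (AddCommGroup (M →ₗ[S] E))

instance DualMod.instFunLike : FunLike (DualMod S E M) M E :=
  inferInstanceAs (FunLike (M →ₗ[S] E) M E)

instance DualMod.instLinearMapClass : LinearMapClass (DualMod S E M) S M E :=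
  inferInstanceAs (LinearMapClass (M →ₗ[S] E) S M E)

@[ext] lemma DualMod.ext {f g : DualMod S E M} (h : ∀ m, f m = g m) : f = g :=
  DFunLike.ext _ _ h

variable {R : Type u} [Ring R] [Module R M] [SMulCommClass S R M]

/-- The action of `r : R` on `M` as an `S`-linear endomorphism. -/
def DualMod.scalarMap (r : R) : M →ₗ[S] M where
  toFun m := r • m
  map_add' := smul_add r
  map_smul' s m := (smul_comm s r m).symm

/-- The dual `Hom_S(M, E)` of a left `R`-module `M` is a right `R`-module,
via `(f • r) m = f (r • m)`. -/
instance DualMod.instSMulRight : SMul Rᵐᵒᵖ (DualMod S E M) where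
  smul r f := ((f : M →ₗ[S] E).comp (DualMod.scalarMap S M r.unop) : M →ₗ[S] E)

lemma DualMod.smul_right_apply (r : Rᵐᵒᵖ) (f : DualMod S E M) (m : M) :
    (r • f) m = f (r.unop • m) := rfl

instance DualMod.moduleRight : Module Rᵐᵒᵖ (DualMod S E M) where
  one_smul f := DualMod.ext _ _ _ fun m => by
    rw [DualMod.smul_right_apply, unop_one, one_smul]
  mul_smul r s f := DualMod.ext _ _ _ fun m => by
    rw [DualMod.smul_right_apply, DualMod.smul_right_apply, DualMod.smul_right_apply,
      unop_mul, mul_smul]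
  smul_zero r := DualMod.ext _ _ _ fun m => rfl
  smul_add r f g := DualMod.ext _ _ _ fun m => rfl
  add_smul r s f := DualMod.ext _ _ _ fun m => by
    show (f : M →ₗ[S] E) ((r + s).unop • m)
      = (f : M →ₗ[S] E) (r.unop • m) + (f : M →ₗ[S] E) (s.unop • m)
    rw [unop_add, add_smul, map_add]
  zero_smul f := DualMod.ext _ _ _ fun m => by
    show (f : M →ₗ[S] E) ((0 : Rᵐᵒᵖ).unop • m) = 0
    rw [unop_zero, zero_smul, map_zero]

end DualMod

/-- Compactness of linear systems over `N`: if every finite subsystem has a solution whose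
coordinate at `i₀` lies outside `K`, then so does the whole system. -/
def IsCompactAvoiding (A : Type u) [Ring A] {N : Type u} [AddCommGroup N] [Module A N]
    (K : AddSubgroup N) : Prop :=
  ∀ (I κ : Type u) (i₀ : I) (r : κ → I →₀ A) (n : κ → N),
    (∀ t : Finset κ, ∃ x : I → N, x i₀ ∉ K ∧ ∀ k ∈ t, Finsupp.linearCombination A x (r k) = n k) →
    ∃ x : I → N, x i₀ ∉ K ∧ ∀ k, Finsupp.linearCombination A x (r k) = n k

namespace IsCompactAvoiding

variable {A : Type u} [Ring A] {N : Type u} [AddCommGroup N] [Module A N] {K : AddSubgroup N}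

/-- Compactness for linear systems whose unknowns are endomorphisms of `N`. -/
lemma exists_endomorphisms (hK : IsCompactAvoiding A K) (ι κ : Type u) (i₀ : ι) (y₀ : N)
    (r : κ → ι × N →₀ A) (n : κ → N)
    (h : ∀ t : Finset κ, ∃ u : ι → Module.End A N, u i₀ y₀ ∉ K ∧
      ∀ k ∈ t, Finsupp.linearCombination A (fun q : ι × N => u q.1 q.2) (r k) = n k) :
    ∃ u : ι → Module.End A N, u i₀ y₀ ∉ K ∧
      ∀ k, Finsupp.linearCombination A (fun q : ι × N => u q.1 q.2) (r k) = n k := by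
  classical
  let lin : ι × A × N × N → ι × N →₀ A := fun q =>
    Finsupp.single (q.1, q.2.1 • q.2.2.1 + q.2.2.2) 1
      - Finsupp.single (q.1, q.2.2.1) q.2.1 - Finsupp.single (q.1, q.2.2.2) 1
  obtain ⟨x, hx₀, hx⟩ := hK (ι × N) ((ι × A × N × N) ⊕ κ) (i₀, y₀) (Sum.elim lin r)
    (Sum.elim 0 n) (fun t => by
      obtain ⟨u, hu₀, hu⟩ := h t.toRight
      refine ⟨fun q => u q.1 q.2, hu₀, ?_⟩
      rintro (⟨i, a, y, z⟩ | k) hk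
      · simp [lin]
      · exact hu k (by simpa using hk))
  have hlin : ∀ i a y z, x (i, a • y + z) = a • x (i, y) + x (i, z) := fun i a y z => by
    have := hx (Sum.inl (i, a, y, z))
    simp only [Sum.elim_inl, lin, map_sub, Finsupp.linearCombination_single, one_smul,
      Pi.zero_apply] at this
    rw [sub_sub, sub_eq_zero] at this
    exact this
  have hzero : ∀ i, x (i, 0) = 0 := fun i => by
    have := hlin i 1 0 0
    simpa using this
  refine ⟨fun i =>
    { toFun := fun y => x (i, y)
      map_add' := fun y z => by simpa using hlin i 1 y z
      map_smul' := fun a y => by simpa [hzero] using hlin i a y 0 }, hx₀, fun k => hx (Sum.inr k)⟩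

/-- On a subset `Y`, there is an endomorphism that is minimal, up to left multiplication, among
those mapping `y₀` outside `K`. -/
lemma exists_minimal_endomorphism (hK : IsCompactAvoiding A K) (Y : Set N) {y₀ : N} (hy₀ : y₀ ∈ Y)
    (hy₀K : y₀ ∉ K) :
    ∃ u : Module.End A N, u y₀ ∉ K ∧ ∀ v : Module.End A N, v (u y₀) ∉ K →
      ∃ w : Module.End A N, ∀ y ∈ Y, w (v (u y)) = u y := by
  classical
  let α := {u : Module.End A N // u y₀ ∉ K}
  let le : α → α → Prop := fun u u' => ∃ w : Module.End A N, ∀ y ∈ Y, w (u.1 y) = u'.1 y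
  have le_refl' : ∀ u, le u u := fun u => ⟨1, fun y _ => rfl⟩
  have le_trans' : ∀ {a b c}, le a b → le b c → le a c := by
    rintro a b c ⟨w, hw⟩ ⟨w', hw'⟩
    exact ⟨w' * w, fun y hy => by rw [Module.End.mul_apply, hw y hy, hw' y hy]⟩
  have : Nonempty α := ⟨⟨1, hy₀K⟩⟩
  have : IsTrans α le := ⟨fun _ _ _ => le_trans'⟩
  have : Std.Refl le := ⟨le_refl'⟩
  obtain ⟨u, hu⟩ := exists_maximal_of_nonempty_chains_bounded (r := le) (fun c hc hne => by
    obtain ⟨i₀, hi₀⟩ := hne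
    have : Nonempty c := ⟨⟨i₀, hi₀⟩⟩
    have hdir : Directed le (fun i : c => i.1) := directedOn_iff_directed.1 hc.directedOn
    obtain ⟨u, hu₀, hu⟩ := hK.exists_endomorphisms c (c × Y) ⟨i₀, hi₀⟩ (i₀.1 y₀)
      (fun k => Finsupp.single (k.1, k.1.1.1 k.2) 1
        - Finsupp.single (⟨i₀, hi₀⟩, i₀.1 k.2) 1) 0 (fun t => by
        obtain ⟨j, hj⟩ := hdir.finset_le (insert ⟨i₀, hi₀⟩ (t.image Prod.fst))
        have hw : ∀ i : c, ∃ w : Module.End A N,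
            i ∈ insert ⟨i₀, hi₀⟩ (t.image Prod.fst) → ∀ y ∈ Y, w (i.1.1 y) = j.1.1 y := by
          intro i
          by_cases hi : i ∈ insert ⟨i₀, hi₀⟩ (t.image Prod.fst)
          · obtain ⟨w, hw⟩ := hj i hi
            exact ⟨w, fun _ => hw⟩
          · exact ⟨0, fun h => absurd h hi⟩
        choose w hw using hw
        have hw₀ := hw ⟨i₀, hi₀⟩ (Finset.mem_insert_self _ _)
        refine ⟨w, ?_, fun k hk => ?_⟩
        · rw [hw₀ y₀ hy₀]
          exact j.1.2
        · have h₁ := hw k.1 (Finset.mem_insert_of_mem (Finset.mem_image_of_mem _ hk)) k.2 k.2.2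
          have h₂ := hw₀ k.2 k.2.2
          simp [h₁, h₂])
    refine ⟨⟨u ⟨i₀, hi₀⟩ * i₀.1, hu₀⟩, fun a ha => ⟨u ⟨a, ha⟩, fun y hy => ?_⟩⟩
    have := hu (⟨a, ha⟩, ⟨y, hy⟩)
    simpa [sub_eq_zero] using this) le_trans'
  refine ⟨u.1, u.2, fun v hv => ?_⟩
  exact hu ⟨v * u.1, hv⟩ ⟨v, fun y _ => rfl⟩

/-- There is a maximal submodule containing `f` on which each endomorphism fixing `f` has a
left inverse. -/
lemma exists_maximal_submodule (hK : IsCompactAvoiding A K) {f : N} (hf : f ∉ K) :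
    ∃ Q : Submodule A N, Maximal (fun Q : Submodule A N => f ∈ Q ∧ ∀ g : Module.End A N, g f = f →
      ∃ u : Module.End A N, ∀ x ∈ Q, u (g x) = x) Q := by
  classical
  obtain ⟨Q, -, hQ⟩ := zorn_le_nonempty₀ {Q : Submodule A N | f ∈ Q ∧ ∀ g : Module.End A N,
      g f = f → ∃ u : Module.End A N, ∀ x ∈ Q, u (g x) = x} (fun c hcs hc P hP => by
    have hdir : DirectedOn (· ≤ ·) c := hc.directedOn
    refine ⟨sSup c, ⟨le_sSup hP (hcs hP).1, fun g hg => ?_⟩, fun z hz => le_sSup hz⟩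
    obtain ⟨u, -, hu⟩ := hK.exists_endomorphisms PUnit (sSup c : Submodule A N) PUnit.unit f
      (fun x => Finsupp.single (PUnit.unit, g x) 1) (fun x => x) (fun t => by
        have hmem : ∀ x : (sSup c : Submodule A N), ∃ Q ∈ c, x.1 ∈ Q := fun x =>
          (Submodule.mem_sSup_of_directed ⟨P, hP⟩ hdir).1 x.2
        choose q hq hxq using hmem
        have : Nonempty c := ⟨⟨P, hP⟩⟩
        obtain ⟨Q, hQ⟩ := (directedOn_iff_directed.1 hdir).finset_le
          (t.image fun x => (⟨q x, hq x⟩ : c))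
        obtain ⟨u, hu⟩ := (hcs Q.2).2 g hg
        refine ⟨fun _ => u, ?_, fun x hx => ?_⟩
        · have := hu f (hcs Q.2).1
          rw [hg] at this
          rwa [this]
        · simpa using hu x (hQ _ (Finset.mem_image_of_mem _ hx) (hxq x)))
    exact ⟨u PUnit.unit, fun x hx => by simpa using hu ⟨x, hx⟩⟩)
    (Submodule.span A {f}) ⟨Submodule.mem_span_singleton_self f, fun g hg => ⟨1, fun x hx => by
      obtain ⟨a, rfl⟩ := Submodule.mem_span_singleton.1 hx
      simp [hg]⟩⟩
  exact ⟨Q, hQ⟩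

/-- There are an element `f ∉ K` that can be recovered from any of its images outside `K`, and an
idempotent fixing `f` on whose range each endomorphism fixing `f` has a left inverse. -/
lemma exists_minimal_idempotent (hK : IsCompactAvoiding A K) (hne : ∃ x, x ∉ K) :
    ∃ f ∉ K, (∀ v : Module.End A N, v f ∉ K → ∃ w : Module.End A N, w (v f) = f) ∧
      ∃ p : Module.End A N, p f = f ∧ IsIdempotentElem p ∧
        ∀ g : Module.End A N, g f = f → ∃ v : Module.End A N, ∀ x, v (g (p x)) = p x := by
  obtain ⟨f₀, hf₀⟩ := hne
  obtain ⟨u₀, hfK, hu₀⟩ := hK.exists_minimal_endomorphism {f₀} rfl hf₀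
  generalize hfdef : u₀ f₀ = f at hfK
  have hf : ∀ v : Module.End A N, v f ∉ K → ∃ w : Module.End A N, w (v f) = f := fun v hv => by
    subst hfdef
    obtain ⟨w, hw⟩ := hu₀ v hv
    exact ⟨w, hw f₀ rfl⟩
  obtain ⟨u, huK, hu⟩ := hK.exists_minimal_endomorphism Set.univ (Set.mem_univ f) hfK
  obtain ⟨h, hh⟩ := hf u huK
  have hmin : ∀ g : Module.End A N, g f = f →
      ∃ v : Module.End A N, ∀ x, v (g (h (u x))) = h (u x) := fun g hg => by
    obtain ⟨w, hw⟩ := hu (g * h) (by rwa [Module.End.mul_apply, hh, hg])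
    exact ⟨h * w, fun x => congrArg h (hw x (Set.mem_univ x))⟩
  obtain ⟨Q, ⟨hfQ, hQ⟩, hQmax⟩ := hK.exists_maximal_submodule hfK
  obtain ⟨s, hs⟩ := hQ (h * u) hh
  have hsf : s f = f := by
    have := hs f hfQ
    rwa [Module.End.mul_apply, hh] at this
  let p : Module.End A N := s * (h * u)
  have hpf : p f = f := hs f hfQ
  have hpmin : ∀ g : Module.End A N, g f = f → ∃ v : Module.End A N, ∀ x, v (g (p x)) = p x :=
    fun g hg => by
      obtain ⟨v, hv⟩ := hmin (g * s) (by rw [Module.End.mul_apply, hsf, hg])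
      exact ⟨s * v, fun x => congrArg s (hv x)⟩
  have hrange : LinearMap.range p ≤ Q := by
    refine hQmax ⟨⟨f, hpf⟩, fun g hg => ?_⟩ fun x hx => ⟨x, hs x hx⟩
    obtain ⟨v, hv⟩ := hpmin g hg
    exact ⟨v, by rintro _ ⟨x, rfl⟩; exact hv x⟩
  exact ⟨f, hfK, hf, p, hpf, LinearMap.ext fun x => hs (p x) (hrange ⟨x, rfl⟩), hpmin⟩

theorem exists_indecomposable_summand (hK : IsCompactAvoiding A K) (hne : ∃ x, x ∉ K) :
    ∃ L L' : Submodule A N, IsCompl L L' ∧ IsIndecomposable A (L : Type u) := by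
  obtain ⟨f, hfK, hf, p, hpf, hp, hmin⟩ := hK.exists_minimal_idempotent hne
  have hpp : ∀ x ∈ LinearMap.range p, p x = x := by
    rintro _ ⟨x, rfl⟩
    exact LinearMap.congr_fun hp x
  refine ⟨LinearMap.range p, LinearMap.ker p, LinearMap.IsIdempotentElem.isCompl hp,
    ⟨⟨f, f, hpf⟩, fun h => hfK ?_⟩, fun U V hU hV hUV => hfK ?_⟩
  · rw [show f = 0 from congrArg Subtype.val h]
    exact K.zero_mem
  · have proj_mem : ∀ (U V : Submodule A (LinearMap.range p)) (h : IsCompl U V), V ≠ ⊥ →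
        ((U.projectionOnto V h ⟨f, f, hpf⟩ : LinearMap.range p) : N) ∈ K := by
      intro U V h hV
      by_contra hmem
      let π : Module.End A N := (LinearMap.range p).subtype ∘ₗ U.subtype ∘ₗ
        U.projectionOnto V h ∘ₗ p.rangeRestrict
      have hπ : ∀ x (hx : x ∈ LinearMap.range p),
          π x = ((U.projectionOnto V h ⟨x, hx⟩ : LinearMap.range p) : N) := fun x hx => by
        have : p.rangeRestrict x = ⟨x, hx⟩ := Subtype.ext (hpp x hx)
        simp [π, this]
      obtain ⟨w, hw⟩ := hf π (by rwa [hπ f ⟨f, hpf⟩])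
      obtain ⟨v, hv⟩ := hmin (w * π) hw
      obtain ⟨x, hxV, hx⟩ := V.exists_mem_ne_zero_of_ne_bot hV
      have hvx := hv x
      rw [hpp x x.2, Module.End.mul_apply, hπ x x.2,
        (Submodule.projectionOnto_apply_eq_zero_iff h).2 hxV] at hvx
      exact hx (Subtype.ext (by simpa using hvx.symm))
    have hadd := Submodule.projection_add_projection_eq_self hUV ⟨f, f, hpf⟩
    have := K.add_mem (proj_mem U V hUV hV) (proj_mem V U hUV.symm hU)
    rwa [Submodule.coe_projectionOnto_apply, Submodule.coe_projectionOnto_apply,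
      ← Submodule.coe_add, hadd] at this

end IsCompactAvoiding

/-- A dual module `Hom_S(M, E)` is compact for linear systems, while avoiding the functionals that
vanish at a given point. -/
theorem isCompactAvoiding_of_dual {R M N : Type u} {S E : Type*} [Ring R] [Ring S]
    [AddCommGroup M] [Module R M] [Module S M] [SMulCommClass S R M] [AddCommGroup E] [Module S E]
    (hinj : ∀ (B : Type u) [AddCommGroup B] [Module S B] (L : Submodule S B) (g : L →ₗ[S] E),
      ∃ h : B →ₗ[S] E, ∀ x : L, h x = g x)
    (hcog : ∀ (X : Type u) [AddCommGroup X] [Module S X] (x : X), x ≠ 0 →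
      ∃ g : X →ₗ[S] E, g x ≠ 0)
    [AddCommGroup N] [Module Rᵐᵒᵖ N] (φ : N ≃+ (M →ₗ[S] E))
    (hφ : ∀ (r : Rᵐᵒᵖ) n m, φ (r • n) m = φ n (r.unop • m))
    (K : AddSubgroup N) (m₀ : M) (hK : ∀ n, n ∈ K ↔ φ n m₀ = 0) :
    IsCompactAvoiding Rᵐᵒᵖ K := by
  classical
  intro I κ i₀ r n hfin
  have := SMulCommClass.symm S R M
  let ρ : (κ →₀ M) →ₗ[S] (I →₀ M) := Finsupp.lsum ℕ fun k => ∑ i ∈ (r k).support,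
    Finsupp.lsingle i ∘ₗ DistribSMul.toLinearMap S M (r k i).unop
  let ν : (κ →₀ M) →ₗ[S] E := Finsupp.lsum ℕ fun k => φ (n k)
  let l : (I → N) → (I →₀ M) →ₗ[S] E := fun x => Finsupp.lsum ℕ fun i => φ (x i)
  have hl : ∀ x i m, l x (Finsupp.single i m) = φ (x i) m := fun x i m => by simp [l]
  have hρ : ∀ k m, ρ (Finsupp.single k m) =
      ∑ i ∈ (r k).support, Finsupp.single i ((r k i).unop • m) := fun k m => by
    simp only [ρ, Finsupp.lsum_single]
    simp
  have hlρ : ∀ x k m, l x (ρ (Finsupp.single k m)) =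
      φ (Finsupp.linearCombination Rᵐᵒᵖ x (r k)) m := fun x k m => by
    simp [hρ, hl, Finsupp.linearCombination_apply, Finsupp.sum, hφ]
  have hsolve : ∀ c, ∃ x, x i₀ ∉ K ∧ l x (ρ c) = ν c := fun c => by
    obtain ⟨x, hx₀, hx⟩ := hfin c.support
    refine ⟨x, hx₀, ?_⟩
    rw [← c.sum_single]
    simp only [Finsupp.sum, map_sum]
    refine Finset.sum_congr rfl fun k hk => ?_
    rw [hlρ, hx k hk]
    simp [ν]
  have hker : LinearMap.ker ρ ≤ LinearMap.ker ν := fun c hc => by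
    obtain ⟨x, -, hx⟩ := hsolve c
    rw [LinearMap.mem_ker] at hc ⊢
    rw [← hx, hc, map_zero]
  obtain ⟨l₁, hl₁⟩ := hinj _ (LinearMap.range ρ)
    ((LinearMap.ker ρ).liftQ ν hker ∘ₗ ρ.quotKerEquivRange.symm.toLinearMap)
  have hl₁ρ : ∀ c, l₁ (ρ c) = ν c := fun c =>
    (hl₁ ⟨ρ c, LinearMap.mem_range_self ρ c⟩).trans <| by
      rw [LinearMap.comp_apply, LinearEquiv.coe_coe,
        LinearMap.quotKerEquivRange_symm_apply_image, Submodule.mkQ_apply, Submodule.liftQ_apply]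
  obtain ⟨l₂, hl₂, hl₂ρ⟩ : ∃ l₂ : (I →₀ M) →ₗ[S] E, l₂ (Finsupp.single i₀ m₀) ≠ 0 ∧
      ∀ c, l₂ (ρ c) = ν c := by
    by_cases h₁ : l₁ (Finsupp.single i₀ m₀) = 0
    · have hnot : Finsupp.single i₀ m₀ ∉ LinearMap.range ρ := by
        rintro ⟨c, hc⟩
        obtain ⟨x, hx₀, hx⟩ := hsolve c
        rw [hK, ← hl, ← hc, hx, ← hl₁ρ, hc] at hx₀
        exact hx₀ h₁
      obtain ⟨g, hg⟩ := hcog ((I →₀ M) ⧸ LinearMap.range ρ)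
        (Submodule.Quotient.mk (Finsupp.single i₀ m₀))
        (by rwa [Ne, Submodule.Quotient.mk_eq_zero])
      refine ⟨l₁ + g ∘ₗ (LinearMap.range ρ).mkQ, by simpa [h₁] using hg, fun c => ?_⟩
      have : (Submodule.Quotient.mk (ρ c) : (I →₀ M) ⧸ LinearMap.range ρ) = 0 :=
        (Submodule.Quotient.mk_eq_zero _).2 ⟨c, rfl⟩
      simp [hl₁ρ, this]
    · exact ⟨l₁, h₁, hl₁ρ⟩
  let x : I → N := fun i => φ.symm (l₂ ∘ₗ Finsupp.lsingle i)
  have hx : l x = l₂ := Finsupp.lhom_ext fun i m => by rw [hl]; simp [x]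
  refine ⟨x, by rwa [hK, ← hl, hx], fun k => φ.injective (LinearMap.ext fun m => ?_)⟩
  rw [← hlρ, hx, hl₂ρ]
  simp [ν]

/-- A dual module `Hom_S(M, E)` of a nonzero module has an indecomposable direct summand. -/
theorem exists_indecomposable_summand_of_dual {R M N : Type u} {S E : Type*} [Ring R] [Ring S]
    [AddCommGroup M] [Module R M] [Module S M] [SMulCommClass S R M] [AddCommGroup E] [Module S E]
    (hinj : ∀ (B : Type u) [AddCommGroup B] [Module S B] (L : Submodule S B) (g : L →ₗ[S] E),
      ∃ h : B →ₗ[S] E, ∀ x : L, h x = g x)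
    (hcog : ∀ (X : Type u) [AddCommGroup X] [Module S X] (x : X), x ≠ 0 →
      ∃ g : X →ₗ[S] E, g x ≠ 0)
    [AddCommGroup N] [Module Rᵐᵒᵖ N] (φ : N ≃+ (M →ₗ[S] E))
    (hφ : ∀ (r : Rᵐᵒᵖ) n m, φ (r • n) m = φ n (r.unop • m)) (hM : ∃ m : M, m ≠ 0) :
    ∃ L L' : Submodule Rᵐᵒᵖ N, IsCompl L L' ∧ IsIndecomposable Rᵐᵒᵖ (L : Type u) := by
  obtain ⟨m₀, hm₀⟩ := hM
  obtain ⟨g, hg⟩ := hcog M m₀ hm₀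
  let K : AddSubgroup N :=
    ((LinearMap.applyₗ' ℕ (R := S) (M := M) (M₂ := E) m₀).toAddMonoidHom.comp
      φ.toAddMonoidHom).ker
  have hK : ∀ n, n ∈ K ↔ φ n m₀ = 0 := fun n => Iff.rfl
  exact (isCompactAvoiding_of_dual hinj hcog φ hφ K m₀ hK).exists_indecomposable_summand
    ⟨φ.symm g, by rwa [hK, AddEquiv.apply_symm_apply]⟩

/-- The character module of a nonzero module has an indecomposable direct summand. -/
theorem Character.exists_indecomposable_summand {R : Type u} [Ring R] (M : Type u) [AddCommGroup M]
    [Module R M] (hM : ∃ m : M, m ≠ 0) :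
    ∃ L L' : Submodule Rᵐᵒᵖ (Character M), IsCompl L L' ∧ IsIndecomposable Rᵐᵒᵖ (L : Type u) := by
  let toLinear {B : Type u} [AddCommGroup B] [Module ℤ B] (h : B →+ RatCircle) :
      B →ₗ[ℤ] RatCircle :=
    { h with map_smul' := fun n x => by simpa using map_intCast_smul h ℤ ℤ n x }
  refine exists_indecomposable_summand_of_dual (S := ℤ) (E := RatCircle) (fun B _ _ L g => ?_)
    (fun X _ _ x hx => ?_)
    (addMonoidHomLequivInt ℤ : (M →+ RatCircle) ≃ₗ[ℤ] (M →ₗ[ℤ] RatCircle)).toAddEquiv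
    (N := Character M) (fun _ _ _ => rfl) hM
  · obtain ⟨h, hh⟩ := (Module.Baer.of_divisible RatCircle).extension_property_addMonoidHom
      L.subtype.toAddMonoidHom L.injective_subtype g.toAddMonoidHom
    exact ⟨toLinear h, fun x => DFunLike.congr_fun hh x⟩
  · obtain ⟨c, hc⟩ := CharacterModule.exists_character_apply_ne_zero_of_ne_zero hx
    exact ⟨toLinear c, hc⟩

theorem dual_has_indecomposable_direct_summand
    {R S : Type u} [Ring R] [Ring S]
    (M : Type u) [AddCommGroup M] [Module R M] [Module S M] [SMulCommClass S R M]
    (hM : ∃ m : M, m ≠ 0)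
    (E : Type u) [AddCommGroup E] [Module S E]
    (hEinj : IsInjectiveModule S E) (hEcog : IsCogenerator S E) :
    (∃ N N' : Submodule Rᵐᵒᵖ (DualMod S E M),
      IsCompl N N' ∧ IsIndecomposable Rᵐᵒᵖ (N : Type u)) ∧
    (∀ (M₀ : Type u) [AddCommGroup M₀] [Module R M₀], (∃ m : M₀, m ≠ 0) →
      ∃ N N' : Submodule Rᵐᵒᵖ (Character M₀),
        IsCompl N N' ∧ IsIndecomposable Rᵐᵒᵖ (N : Type u)) := by
  refine ⟨exists_indecomposable_summand_of_dual hEinj hEcog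
    (AddEquiv.refl (M →ₗ[S] E) : DualMod S E M ≃+ (M →ₗ[S] E)) (fun _ _ _ => rfl) hM, ?_⟩
  exact fun M₀ _ _ hM₀ => Character.exists_indecomposable_summand M₀ hM₀

end
end

section
/- Let R and S be rings, let M be a nonzero left R-module carrying an S-module structure commuting with the R-action, and let E be an injective cogenerator of the category of S-modules; write M* = Hom_S(M, E) for the dual right R-module. Then there is a family (N_j)_{j∈J} of indecomposable right R-modules, each isomorphic to a direct summand of M*, such that M* is isomorphic to a direct summand of the direct product ∏_{j∈J} N_j. -/
universe u

open MulOpposite DirectSum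

noncomputable section

open scoped TensorProduct

theorem IsInjectiveModule.exists_factor {S : Type u} [Ring S] {E : Type u} [AddCommGroup E]
    [Module S E] (hE : IsInjectiveModule S E) {X B : Type u} [AddCommGroup X] [Module S X]
    [AddCommGroup B] [Module S B] (F : X →ₗ[S] B) (G : X →ₗ[S] E)
    (h : LinearMap.ker F ≤ LinearMap.ker G) :
    ∃ φ : B →ₗ[S] E, ∀ x, φ (F x) = G x := by
  obtain ⟨φ, hφ⟩ := hE B (LinearMap.range F)
    (((LinearMap.ker F).liftQ G h).comp F.quotKerEquivRange.symm.toLinearMap)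
  refine ⟨φ, fun x => (hφ ⟨F x, x, rfl⟩).trans ?_⟩
  have hx : F.quotKerEquivRange.symm ⟨F x, x, rfl⟩ = Submodule.Quotient.mk x :=
    F.quotKerEquivRange_symm_apply_image x ⟨x, rfl⟩
  simp only [LinearMap.comp_apply, LinearEquiv.coe_coe]
  rw [hx]
  exact Submodule.liftQ_apply _ _ _

section PrimitiveIdempotents

variable {S A T E : Type u} [Ring S] [Ring A] [AddCommGroup T] [Module S T]
  [AddCommGroup E] [Module S E]

/-- An `S`-submodule `K` of `T` is saturated if every `a : A` with `ev (a K) = 0` kills `K`. -/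
def IsSaturated (ρ : A →+* Module.End S T) (ev : T →ₗ[S] E) (K : Submodule S T) : Prop :=
  ∀ a : A, (∀ k ∈ K, ev (ρ a k) = 0) → ∀ k ∈ K, ρ a k = 0

/-- The functional `ev` identifies the ring `A` acting on `T` with `Hom_S(T, E)`. -/
structure RepresentsDual (ρ : A →+* Module.End S T) (ev : T →ₗ[S] E) : Prop where
  surj : ∀ φ : T →ₗ[S] E, ∃ a : A, ∀ t, ev (ρ a t) = φ t
  inj : ∀ a : A, (∀ t, ev (ρ a t) = 0) → a = 0

variable {ρ : A →+* Module.End S T} {ev : T →ₗ[S] E}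

theorem isSaturated_bot : IsSaturated ρ ev ⊥ := by
  rintro a - k hk
  rw [(Submodule.mem_bot S).1 hk, map_zero]

theorem isSaturated_sSup {c : Set (Submodule S T)} (hc : ∀ K ∈ c, IsSaturated ρ ev K) :
    IsSaturated ρ ev (sSup c) := by
  intro a ha
  have : sSup c ≤ LinearMap.ker (ρ a) :=
    sSup_le fun K hK k hk => hc K hK a (fun x hx => ha x (le_sSup hK hx)) k hk
  exact fun k hk => this hk

theorem RepresentsDual.isSaturated_range (h : RepresentsDual ρ ev) (a : A) :
    IsSaturated ρ ev (LinearMap.range (ρ a)) := by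
  rintro b hb _ ⟨t, rfl⟩
  have : b * a = 0 := h.inj _ fun t => by
    rw [map_mul]
    exact hb _ ⟨t, rfl⟩
  rw [← Module.End.mul_apply, ← map_mul, this, map_zero, LinearMap.zero_apply]

theorem RepresentsDual.isSaturated_comap (h : RepresentsDual ρ ev) (hE : IsInjectiveModule S E)
    (a : A) {K : Submodule S T} (hK : IsSaturated ρ ev K) :
    IsSaturated ρ ev (K.comap (ρ a)) := by
  intro b hb t ht
  obtain ⟨φ, hφ⟩ := hE.exists_factor ((ρ a).coprod K.subtype)
    ((ev.comp (ρ b)).comp (LinearMap.fst S T K)) (by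
      rintro ⟨x, k⟩ hx
      have hx : ρ a x + (k : T) = 0 := hx
      refine hb x ?_
      rw [Submodule.mem_comap, eq_neg_of_add_eq_zero_left hx]
      exact K.neg_mem k.2)
  obtain ⟨c, hc⟩ := h.surj φ
  have hcK : ∀ k ∈ K, ρ c k = 0 := hK c fun k hk => by
    simpa [hc] using hφ (0, ⟨k, hk⟩)
  have hca : c * a - b = 0 := h.inj _ fun x => by
    have := hφ (x, 0)
    simp only [LinearMap.coprod_apply, map_zero, add_zero, ← hc] at this
    simpa [sub_eq_zero] using this
  rw [← sub_eq_zero.1 hca, map_mul]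
  exact hcK _ ht

theorem RepresentsDual.isSaturated_ker (h : RepresentsDual ρ ev) (hE : IsInjectiveModule S E)
    (a : A) : IsSaturated ρ ev (LinearMap.ker (ρ a)) :=
  h.isSaturated_comap hE a isSaturated_bot

theorem exists_maximal_isSaturated_notMem {t : T} (ht : t ≠ 0) :
    ∃ C, Maximal (fun K : Submodule S T => IsSaturated ρ ev K ∧ t ∉ K) C := by
  obtain ⟨C, -, hC⟩ := zorn_le_nonempty₀ {K : Submodule S T | IsSaturated ρ ev K ∧ t ∉ K}
    (fun c hc hchain y hy => ⟨sSup c, ⟨isSaturated_sSup fun K hK => (hc hK).1, fun hmem => by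
      obtain ⟨K, hK, htK⟩ := (Submodule.mem_sSup_of_directed ⟨y, hy⟩ hchain.directedOn).1 hmem
      exact (hc hK).2 htK⟩, fun K hK => le_sSup hK⟩) ⊥
    ⟨isSaturated_bot, fun hmem => ht ((Submodule.mem_bot S).1 hmem)⟩
  exact ⟨C, hC⟩

/-- If the kernel of `a` is maximal among saturated submodules avoiding `t`, then `a t` lies in
every saturated submodule that meets the range of `a`. -/
theorem RepresentsDual.mem_of_inf_range_ne_bot (h : RepresentsDual ρ ev)
    (hE : IsInjectiveModule S E) {t : T} {a : A}
    (ha : Maximal (fun K : Submodule S T => IsSaturated ρ ev K ∧ t ∉ K) (LinearMap.ker (ρ a)))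
    {K : Submodule S T} (hK : IsSaturated ρ ev K) (hne : K ⊓ LinearMap.range (ρ a) ≠ ⊥) :
    ρ a t ∈ K := by
  by_contra hmem
  obtain ⟨_, ⟨hxK, x, rfl⟩, hx⟩ := Submodule.exists_mem_ne_zero_of_ne_bot hne
  exact hx (ha.le_of_ge ⟨h.isSaturated_comap hE a hK, hmem⟩
    (fun y hy => by
      rw [Submodule.mem_comap, LinearMap.mem_ker.1 hy]
      exact K.zero_mem) hxK)

theorem RepresentsDual.exists_ker_maximal (h : RepresentsDual ρ ev)
    (hE : IsInjectiveModule S E) (hcog : IsCogenerator S E) {t : T} (ht : t ≠ 0) :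
    ∃ a : A, Maximal (fun K : Submodule S T => IsSaturated ρ ev K ∧ t ∉ K)
      (LinearMap.ker (ρ a)) := by
  obtain ⟨C, hC⟩ := exists_maximal_isSaturated_notMem (ρ := ρ) (ev := ev) ht
  obtain ⟨g, hg⟩ := hcog (T ⧸ C) (Submodule.Quotient.mk t)
    (fun h0 => hC.prop.2 ((Submodule.Quotient.mk_eq_zero C).1 h0))
  obtain ⟨a, ha⟩ := h.surj (g.comp C.mkQ)
  have hCa : C ≤ LinearMap.ker (ρ a) := hC.prop.1 a fun k hk => by
    rw [ha, LinearMap.comp_apply, Submodule.mkQ_apply, (Submodule.Quotient.mk_eq_zero C).2 hk,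
      map_zero]
  have hta : t ∉ LinearMap.ker (ρ a) := fun h0 => hg <| by
    have := ha t
    rw [LinearMap.mem_ker.1 h0, map_zero] at this
    exact this.symm
  have : LinearMap.ker (ρ a) = C :=
    le_antisymm (hC.le_of_ge ⟨h.isSaturated_ker hE a, hta⟩ hCa) hCa
  exact ⟨a, this ▸ hC⟩

theorem RepresentsDual.exists_primitive_idempotent (h : RepresentsDual ρ ev)
    (hE : IsInjectiveModule S E) (hcog : IsCogenerator S E) {t : T} (ht : t ≠ 0) :
    ∃ e a : A, IsIdempotentElem e ∧ ρ (e * a) t ≠ 0 ∧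
      ∀ e₁ e₂ : A, e₁ + e₂ = e → e₁ * e₂ = 0 → e₂ * e₁ = 0 →
        IsIdempotentElem e₁ → IsIdempotentElem e₂ → e₁ = 0 ∨ e₂ = 0 := by
  obtain ⟨a, ha⟩ := h.exists_ker_maximal hE hcog ht
  set t₀ := ρ a t with ht₀_eq
  have ht₀ : t₀ ≠ 0 := ha.prop.2
  obtain ⟨D, haD, hD⟩ := zorn_le_nonempty₀
    {D : Submodule S T | IsSaturated ρ ev D ∧ ∀ K, IsSaturated ρ ev K → K ⊓ D ≠ ⊥ → t₀ ∈ K}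
    (fun c hc hchain y hy => ⟨sSup c, ⟨isSaturated_sSup fun K hK => (hc hK).1, fun K hK hne => by
      obtain ⟨x, ⟨hxK, hxc⟩, hx⟩ := Submodule.exists_mem_ne_zero_of_ne_bot hne
      obtain ⟨D, hDc, hxD⟩ :=
        (Submodule.mem_sSup_of_directed ⟨y, hy⟩ hchain.directedOn).1 hxc
      exact (hc hDc).2 K hK ((Submodule.ne_bot_iff _).2 ⟨x, ⟨hxK, hxD⟩, hx⟩)⟩,
      fun K hK => le_sSup hK⟩)
    (LinearMap.range (ρ a))
    ⟨h.isSaturated_range a, fun K hK hne => h.mem_of_inf_range_ne_bot hE ha hK hne⟩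
  have ht₀D : t₀ ∈ D := haD ⟨t, rfl⟩
  obtain ⟨U, hU⟩ := exists_maximal_isSaturated_notMem (ρ := ρ) (ev := ev) ht₀
  have hUD : U ⊓ D = ⊥ := by
    by_contra hne
    exact hU.prop.2 (hD.prop.2 U hU.prop.1 hne)
  obtain ⟨φ, hφ⟩ := hE.exists_factor (D.subtype.coprod U.subtype)
    ((ev.comp D.subtype).comp (LinearMap.fst S D U)) (by
      rintro ⟨d, u⟩ hdu
      have hdu : (d : T) + (u : T) = 0 := hdu
      have hd : (d : T) ∈ U ⊓ D :=
        ⟨by rw [eq_neg_of_add_eq_zero_left hdu]; exact U.neg_mem u.2, d.2⟩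
      rw [hUD, Submodule.mem_bot] at hd
      simp [hd])
  obtain ⟨e, he⟩ := h.surj φ
  have heU : U ≤ LinearMap.ker (ρ e) := hU.prop.1 e fun u hu => by
    simpa [he] using hφ (0, ⟨u, hu⟩)
  have heD : ∀ d ∈ D, ρ e d = d := fun d hd => by
    have := hD.prop.1 (e - 1) (fun d hd => by
      simpa [he, sub_eq_zero] using hφ (⟨d, hd⟩, 0)) d hd
    simpa [sub_eq_zero] using this
  have het₀ : ρ e t₀ = t₀ := heD t₀ ht₀D
  have hker : LinearMap.ker (ρ e) = U :=
    le_antisymm (hU.le_of_ge ⟨h.isSaturated_ker hE e, fun h0 => ht₀ (het₀ ▸ h0)⟩ heU) heU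
  have hess : ∀ K, IsSaturated ρ ev K → K ⊓ LinearMap.range (ρ e) ≠ ⊥ → t₀ ∈ K :=
    fun K hK hne => het₀ ▸ h.mem_of_inf_range_ne_bot hE (hker.symm ▸ hU) hK hne
  have hrange : LinearMap.range (ρ e) ≤ D :=
    hD.le_of_ge ⟨h.isSaturated_range e, hess⟩ fun d hd => ⟨d, heD d hd⟩
  refine ⟨e, a, sub_eq_zero.1 (h.inj _ fun x => ?_), ?_, ?_⟩
  · simp [heD _ (hrange ⟨x, rfl⟩)]
  · rw [map_mul, Module.End.mul_apply, ← ht₀_eq, het₀]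
    exact ht₀
  · intro e₁ e₂ hsum h₁₂ h₂₁ h₁ h₂
    have key : ∀ f : A, IsIdempotentElem f → e * f = f → f ≠ 0 → ρ f t₀ = t₀ := by
      intro f hf hef hf0
      obtain ⟨y, hy⟩ := hess _ (h.isSaturated_range f) (fun hbot => hf0 <| h.inj f fun x => by
        have : ρ f x ∈ LinearMap.range (ρ f) ⊓ LinearMap.range (ρ e) :=
          ⟨⟨x, rfl⟩, ρ f x, by rw [← Module.End.mul_apply, ← map_mul, hef]⟩
        rw [hbot, Submodule.mem_bot] at this
        rw [this, map_zero])
      rw [← hy, ← Module.End.mul_apply, ← map_mul, hf.eq]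
    by_contra! hne
    have k₁ := key e₁ h₁ (by rw [← hsum, add_mul, h₁.eq, h₂₁, add_zero]) hne.1
    have k₂ := key e₂ h₂ (by rw [← hsum, add_mul, h₂.eq, h₁₂, zero_add]) hne.2
    apply ht₀
    rw [← k₁, ← k₂, ← Module.End.mul_apply, ← map_mul, h₁₂, map_zero, LinearMap.zero_apply]

end PrimitiveIdempotents

section BalancedTensor

variable (R S : Type u) [Ring R] [Ring S] (M : Type u) [AddCommGroup M] [Module R M]
  [Module S M] {E : Type u} [AddCommGroup E] [Module S E]

/-- The `S`-submodule of `M ⊗[ℤ] Q` generated by the `R`-balancing relations. -/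
def balancingRelations (Q : Type u) [AddCommGroup Q] [Module Rᵐᵒᵖ Q] :
    Submodule S (M ⊗[ℤ] Q) :=
  Submodule.span S
    {x | ∃ (r : R) (m : M) (q : Q), x = (r • m) ⊗ₜ[ℤ] q - m ⊗ₜ[ℤ] (op r • q)}

/-- The tensor product `Q ⊗_R M` of a right `R`-module `Q` with `M`, as an `S`-module. -/
abbrev BalancedTensor (Q : Type u) [AddCommGroup Q] [Module Rᵐᵒᵖ Q] : Type u :=
  (M ⊗[ℤ] Q) ⧸ balancingRelations R S M Q

namespace BalancedTensor

variable {Q Q' Q'' : Type u} [AddCommGroup Q] [Module Rᵐᵒᵖ Q] [AddCommGroup Q']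
  [Module Rᵐᵒᵖ Q'] [AddCommGroup Q''] [Module Rᵐᵒᵖ Q'']

/-- The class of a pure tensor. -/
def tmul (m : M) (q : Q) : BalancedTensor R S M Q :=
  (balancingRelations R S M Q).mkQ (m ⊗ₜ[ℤ] q)

theorem tmul_smul (r : R) (m : M) (q : Q) :
    tmul R S M m (op r • q) = tmul R S M (r • m) q :=
  ((Submodule.Quotient.eq (balancingRelations R S M Q)).2
    (Submodule.subset_span ⟨r, m, q, rfl⟩)).symm

variable {R S M}

theorem hom_ext {P : Type u} [AddCommGroup P] [Module S P]
    {f g : BalancedTensor R S M Q →ₗ[S] P}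
    (h : ∀ m q, f (tmul R S M m q) = g (tmul R S M m q)) : f = g := by
  refine Submodule.linearMap_qext _ (LinearMap.ext fun x => ?_)
  induction x using TensorProduct.induction_on with
  | zero => rw [map_zero, map_zero]
  | tmul m q => exact h m q
  | add x y hx hy => rw [map_add, map_add, hx, hy]

/-- The map `Q ⊗_R M → Q' ⊗_R M` induced by a map of right `R`-modules. -/
def map (f : Q →ₗ[Rᵐᵒᵖ] Q') : BalancedTensor R S M Q →ₗ[S] BalancedTensor R S M Q' :=
  Submodule.mapQ _ _
    (TensorProduct.AlgebraTensorModule.map (LinearMap.id : M →ₗ[S] M)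
      f.toAddMonoidHom.toIntLinearMap) <| by
    refine Submodule.span_le.2 ?_
    rintro _ ⟨r, m, q, rfl⟩
    refine Submodule.subset_span ⟨r, m, f q, ?_⟩
    simp

theorem map_tmul (f : Q →ₗ[Rᵐᵒᵖ] Q') (m : M) (q : Q) :
    map f (tmul R S M m q) = tmul R S M m (f q) := rfl

theorem map_comp (g : Q' →ₗ[Rᵐᵒᵖ] Q'') (f : Q →ₗ[Rᵐᵒᵖ] Q') :
    map (S := S) (M := M) (g.comp f) = (map g).comp (map f) :=
  hom_ext fun _ _ => rfl

variable (R S M Q) in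
/-- The action of the endomorphism ring of `Q` on `Q ⊗_R M`. -/
def endAction : Module.End Rᵐᵒᵖ Q →+* Module.End S (BalancedTensor R S M Q) where
  toFun := map
  map_one' := hom_ext fun _ _ => rfl
  map_mul' g f := map_comp g f
  map_zero' := hom_ext fun m q => by
    rw [map_tmul, LinearMap.zero_apply, tmul, TensorProduct.tmul_zero, map_zero,
      LinearMap.zero_apply]
  map_add' f g := hom_ext fun m q => by
    rw [LinearMap.add_apply, map_tmul, map_tmul, map_tmul, LinearMap.add_apply, tmul,
      TensorProduct.tmul_add, map_add]
    rfl

variable [SMulCommClass S R M]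

/-- The functional on `Q ⊗_R M` attached to a map `Q → Hom_S(M, E)`. -/
def uncurry (φ : Q →ₗ[Rᵐᵒᵖ] DualMod S E M) : BalancedTensor R S M Q →ₗ[S] E :=
  Submodule.liftQ _
    (TensorProduct.AlgebraTensorModule.lift
      (LinearMap.mk₂' S ℤ (fun (m : M) (q : Q) => φ q m)
        (fun m m' q => map_add (φ q) m m') (fun s m q => map_smul (φ q) s m)
        (fun m q q' => by rw [map_add]; rfl)
        (fun n m q => by rw [map_zsmul]; rfl))) <| by
    refine Submodule.span_le.2 ?_
    rintro _ ⟨r, m, q, rfl⟩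
    simp [DualMod.smul_right_apply]

/-- The map `Q → Hom_S(M, E)` attached to a functional on `Q ⊗_R M`. -/
def curry (ψ : BalancedTensor R S M Q →ₗ[S] E) : Q →ₗ[Rᵐᵒᵖ] DualMod S E M where
  toFun q := (ψ.comp ((balancingRelations R S M Q).mkQ.comp
    ((TensorProduct.AlgebraTensorModule.mk ℤ S M Q).flip q)) : M →ₗ[S] E)
  map_add' q q' := DualMod.ext _ _ _ fun m => by
    change ψ (Submodule.mkQ _ (m ⊗ₜ[ℤ] (q + q'))) =
      ψ (Submodule.mkQ _ (m ⊗ₜ[ℤ] q)) + ψ (Submodule.mkQ _ (m ⊗ₜ[ℤ] q'))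
    rw [TensorProduct.tmul_add, map_add, map_add]
  map_smul' r q := DualMod.ext _ _ _ fun m => congrArg ψ (tmul_smul R S M r.unop m q)

theorem representsDual_endAction :
    RepresentsDual (endAction R S M (DualMod S E M))
      (uncurry (LinearMap.id : DualMod S E M →ₗ[Rᵐᵒᵖ] DualMod S E M)) where
  surj φ := ⟨curry φ, LinearMap.congr_fun (f := (uncurry LinearMap.id).comp (map (curry φ)))
    (hom_ext fun _ _ => rfl)⟩
  inj _ ha := LinearMap.ext fun f => DualMod.ext _ _ _ fun m => ha (tmul R S M m f)

end BalancedTensor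

end BalancedTensor

theorem isIndecomposable_range {A N : Type u} [Ring A] [AddCommGroup N] [Module A N]
    {e : Module.End A N} (he : IsIdempotentElem e) (he0 : e ≠ 0)
    (hprim : ∀ e₁ e₂ : Module.End A N, e₁ + e₂ = e → e₁ * e₂ = 0 → e₂ * e₁ = 0 →
      IsIdempotentElem e₁ → IsIdempotentElem e₂ → e₁ = 0 ∨ e₂ = 0) :
    IsIndecomposable A (LinearMap.range e) := by
  have hfix : ∀ x : LinearMap.range e, e.rangeRestrict x = x := by
    rintro ⟨_, y, rfl⟩
    exact Subtype.ext (LinearMap.congr_fun he.eq y)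
  constructor
  · obtain ⟨y, hy⟩ : ∃ y, e y ≠ 0 := by
      by_contra! h0
      exact he0 (LinearMap.ext h0)
    exact ⟨⟨e y, y, rfl⟩, fun h0 => hy (congrArg Subtype.val h0)⟩
  · intro U V hU hV hUV
    let f (p : Module.End A (LinearMap.range e)) : Module.End A N :=
      (LinearMap.range e).subtype ∘ₗ p ∘ₗ e.rangeRestrict
    have hmul : ∀ p q, f p * f q = f (p * q) := fun p q => LinearMap.ext fun y => by
      change ((p (e.rangeRestrict ((q (e.rangeRestrict y) : LinearMap.range e) : N)) :
        LinearMap.range e) : N) = _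
      rw [hfix]
      rfl
    have hzero : f 0 = 0 := LinearMap.ext fun y => rfl
    have hinj : ∀ p, f p = 0 → p = 0 := fun p hp => LinearMap.ext fun x => Subtype.ext <| by
      have := LinearMap.congr_fun hp (x : N)
      change ((p (e.rangeRestrict (x : N)) : LinearMap.range e) : N) = 0 at this
      rwa [hfix] at this
    have hadd : U.projection V hUV + V.projection U hUV.symm = 1 :=
      Submodule.projection_add_projection_eq_id hUV
    have hUid := Submodule.isIdempotentElem_projection hUV
    have hVid := Submodule.isIdempotentElem_projection hUV.symm
    have hUV0 : U.projection V hUV * V.projection U hUV.symm = 0 := LinearMap.ext fun x =>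
      (Submodule.projection_apply_eq_zero_iff hUV).2 (Submodule.projection_apply_mem hUV.symm x)
    have hVU0 : V.projection U hUV.symm * U.projection V hUV = 0 := LinearMap.ext fun x =>
      (Submodule.projection_apply_eq_zero_iff hUV.symm).2 (Submodule.projection_apply_mem hUV x)
    have hsum : f (U.projection V hUV) + f (V.projection U hUV.symm) = e :=
      LinearMap.ext fun y => congrArg Subtype.val (LinearMap.congr_fun hadd (e.rangeRestrict y))
    rcases hprim _ _ hsum (by rw [hmul, hUV0, hzero]) (by rw [hmul, hVU0, hzero])
      ((hmul _ _).trans (congrArg f hUid.eq)) ((hmul _ _).trans (congrArg f hVid.eq)) with h0 | h0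
    · exact hU (by rw [← Submodule.range_projection hUV, hinj _ h0, LinearMap.range_zero])
    · exact hV (by rw [← Submodule.range_projection hUV.symm, hinj _ h0, LinearMap.range_zero])

theorem dual_cogenerated_by_indecomposable_summands
    {R S : Type u} [Ring R] [Ring S]
    (M : Type u) [AddCommGroup M] [Module R M] [Module S M] [SMulCommClass S R M]
    (hM : ∃ m : M, m ≠ 0)
    (E : Type u) [AddCommGroup E] [Module S E]
    (hEinj : IsInjectiveModule S E) (hEcog : IsCogenerator S E) :
    ∃ (J : Type u) (N : J → ModuleCat.{u} Rᵐᵒᵖ),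
      (∀ j, IsIndecomposable Rᵐᵒᵖ (N j : Type u) ∧
        IsDirectSummand Rᵐᵒᵖ (N j : Type u) (DualMod S E M)) ∧
      IsDirectSummand Rᵐᵒᵖ (DualMod S E M) (∀ j, (N j : Type u)) := by
  let A := Module.End Rᵐᵒᵖ (DualMod S E M)
  let J : Type u := {p : A × A // IsIdempotentElem p.1 ∧
    IsIndecomposable Rᵐᵒᵖ (LinearMap.range p.1)}
  let N (j : J) : ModuleCat.{u} Rᵐᵒᵖ := ModuleCat.of Rᵐᵒᵖ (LinearMap.range j.1.1)
  refine ⟨J, N, fun j => ⟨j.2.2, (LinearMap.range j.1.1).subtype, j.1.1.rangeRestrict, ?_⟩, ?_⟩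
  · refine LinearMap.ext ?_
    rintro ⟨_, y, rfl⟩
    exact Subtype.ext (LinearMap.congr_fun j.2.1.eq y)
  · let i : DualMod S E M →ₗ[Rᵐᵒᵖ] (∀ j, (N j : Type u)) :=
      LinearMap.pi fun j => j.1.1.rangeRestrict ∘ₗ j.1.2
    have hrep := BalancedTensor.representsDual_endAction (R := R) (S := S) (M := M) (E := E)
    obtain ⟨φ, hφ⟩ := hEinj.exists_factor (BalancedTensor.map (S := S) (M := M) i)
      (BalancedTensor.uncurry (LinearMap.id : DualMod S E M →ₗ[Rᵐᵒᵖ] DualMod S E M)) (by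
        intro t ht
        by_contra hne
        have ht0 : t ≠ 0 := fun h0 => hne (h0 ▸ Submodule.zero_mem _)
        obtain ⟨e, a, he, hea, hprim⟩ := hrep.exists_primitive_idempotent hEinj hEcog ht0
        have he0 : e ≠ 0 := by
          rintro rfl
          exact hea (by rw [zero_mul, map_zero, LinearMap.zero_apply])
        let j : J := ⟨(e, a), he, isIndecomposable_range he he0 hprim⟩
        have hcomp : e * a = ((LinearMap.range e).subtype ∘ₗ
            (LinearMap.proj j : (∀ j, (N j : Type u)) →ₗ[Rᵐᵒᵖ] N j)) ∘ₗ i := rfl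
        apply hea
        change BalancedTensor.map (e * a) t = 0
        rw [hcomp, BalancedTensor.map_comp, LinearMap.comp_apply, LinearMap.mem_ker.1 ht,
          map_zero])
    exact ⟨i, BalancedTensor.curry φ, LinearMap.ext fun f => DualMod.ext _ _ _ fun m =>
      hφ (BalancedTensor.tmul R S M m f)⟩

end
end
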